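/- Fix k ∈ (0,1) and t = k/4. For every integer m ≥ 1, Σ_{n=1}^∞ (1/2 + C_n(t))·n·a_{n,m} = (−1)^m · (π/(8(1−k)K(k))) · m·(q_k^{−m} − q_k^{m}) / (q_k^{m/4} + q_k^{−m/4})², the sum converging absolutely, where C_n(t) = Σ_w t^{|w|} is the sum over all nonempty simple diagonal walks w with w_0 = (n,0) and w_i ∈ ℤ_{>0}×ℤ_{>0} for 1 ≤ i ≤ |w|. -/

import Mathlib

open Complex Real Set

noncomputable section

/-- A lattice point `(x,y)` viewed as the complex number `x + iy`. -/
def ptC (p : ℤ × ℤ) : ℂ := (p.1 : ℂ) + (p.2 : ℂ) * Complex.I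

/-- A diagonal step on `ℤ²`. -/
def IsDiagStep (a b : ℤ × ℤ) : Prop :=
  b - a = (1, 1) ∨ b - a = (1, -1) ∨ b - a = (-1, -1) ∨ b - a = (-1, 1)

/-- A rectilinear step on `ℤ²`. -/
def IsRectStep (a b : ℤ × ℤ) : Prop :=
  b - a = (1, 0) ∨ b - a = (-1, 0) ∨ b - a = (0, 1) ∨ b - a = (0, -1)

/-- `w` encodes a simple diagonal walk `(w₀, …, w_n)` as a list of length `n+1`. -/
def IsWalkList (w : List (ℤ × ℤ)) : Prop := w ≠ [] ∧ w.Chain' IsDiagStep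

/-- Winding angle of the walk `w` around the origin up to time `i`. -/
def windTo (w : List (ℤ × ℤ)) (i : ℕ) : ℝ :=
  ∑ j ∈ Finset.range i, (ptC (w.getD (j + 1) 0) / ptC (w.getD j 0)).arg

/-- The full winding angle of the walk `w` around the origin. -/
def wind (w : List (ℤ × ℤ)) : ℝ := windTo w (w.length - 1)

/-- The condition on walks counted by `W^{(α,I)}_{l,p}`: a simple diagonal walk on
`ℤ² ∖ {0}` from `(p,0)` to a point on one of the axes at distance `l` from the origin,
with full winding angle `α` and intermediate winding angles in `I`. -/
def WCond (l p : ℕ) (α : ℝ) (I : Set ℝ) (w : List (ℤ × ℤ)) : Prop :=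
  IsWalkList w ∧ (∀ x ∈ w, x ≠ (0, 0)) ∧ w.head? = some ((p : ℤ), 0) ∧
    (w.getLast? = some ((l : ℤ), 0) ∨ w.getLast? = some (-(l : ℤ), 0) ∨
      w.getLast? = some (0, (l : ℤ)) ∨ w.getLast? = some (0, -(l : ℤ))) ∧
    wind w = α ∧ (∀ i, 1 ≤ i → i ≤ w.length - 2 → windTo w i ∈ I)

/-- The generating function `W^{(α,I)}_{l,p}(t)`. -/
def Wgen (t : ℝ) (l p : ℕ) (α : ℝ) (I : Set ℝ) : ℝ :=
  ∑' w : {w : List (ℤ × ℤ) // WCond l p α I w}, t ^ (w.val.length - 1)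

/-- The complete elliptic integral of the first kind `K(k)`. -/
def Kell (k : ℝ) : ℝ := ∫ y in (0:ℝ)..1, 1 / Real.sqrt ((1 - y ^ 2) * (1 - k ^ 2 * y ^ 2))

/-- The complete elliptic integral of the second kind `E(k)`. -/
def Eell (k : ℝ) : ℝ := ∫ y in (0:ℝ)..1, Real.sqrt (1 - k ^ 2 * y ^ 2) / Real.sqrt (1 - y ^ 2)

/-- The complementary modulus `k' = √(1-k²)`. -/
def kComp (k : ℝ) : ℝ := Real.sqrt (1 - k ^ 2)

/-- The elliptic nome `q_k = exp(-π K(k')/K(k))`. -/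
def qNome (k : ℝ) : ℝ := Real.exp (-π * Kell (kComp k) / Kell k)

/-- The descending Landen transformation `k₁ = (1-k')/(1+k')`. -/
def kLanden (k : ℝ) : ℝ := (1 - kComp k) / (1 + kComp k)

/-- `T_k = K(k')/(4K(k))`. -/
def Tell (k : ℝ) : ℝ := Kell (kComp k) / (4 * Kell k)

/-- The plane minus the two real slits `{z ∈ ℝ : z² ≥ κ}`. -/
def slitDom (κ : ℝ) : Set ℂ := {z : ℂ | ¬(z.im = 0 ∧ κ ≤ z.re ^ 2)}

/-- `v` is the analytic function `v_κ` on `ℂ ∖ {z ∈ ℝ : z² ≥ κ}` with `v 0 = 0` and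
`v'(z) = 1/(4K(κ)√((κ-z²)(1-κz²)))`, the branch of the square root being positive on
`(-√κ, √κ)` (by analytic continuation this determines `v` uniquely). -/
structure IsVmap (κ : ℝ) (v : ℂ → ℂ) : Prop where
  map_zero : v 0 = 0
  analytic : AnalyticOnNhd ℂ v (slitDom κ)
  deriv_real : ∀ x : ℝ, x ^ 2 < κ →
    HasDerivAt v ((1 / (4 * Kell κ * Real.sqrt ((κ - x ^ 2) * (1 - κ * x ^ 2))) : ℝ) : ℂ)
      (x : ℂ)

/-- The function `f_m(z) = cos(2πm(v(z) + 1/4)) - cos(πm/2)` built from `v = v_{k₁}`. -/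
def fmFun (v : ℂ → ℂ) (m : ℕ) (z : ℂ) : ℂ :=
  Complex.cos (2 * (π : ℂ) * m * (v z + 1 / 4)) - Complex.cos ((π : ℂ) * m / 2)

/-- `a n m` is the (real) Taylor coefficient `[zⁿ] f_m(z)` at `0`. -/
def IsCoeff (κ : ℝ) (v : ℂ → ℂ) (a : ℕ → ℕ → ℝ) : Prop :=
  ∀ m : ℕ, 1 ≤ m → ∀ z : ℂ, z ∈ slitDom κ → ‖z‖ < 1 →
    HasSum (fun n : ℕ => (a n m : ℂ) * z ^ n) (fmFun v m z)

/-- An excursion: a nonempty simple diagonal walk from the origin to the origin with no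
intermediate visits to the origin. -/
def IsExcursion (w : List (ℤ × ℤ)) : Prop :=
  2 ≤ w.length ∧ w.Chain' IsDiagStep ∧ w.head? = some (0, 0) ∧ w.getLast? = some (0, 0) ∧
    ∀ i, 1 ≤ i → i ≤ w.length - 2 → w.getD i 0 ≠ (0, 0)

/-- The winding angle sequence of an excursion: `θ₀ = θ₁ = 0`, increments of the first and
last step do not contribute, and `θ_n = θ_{n-1}`. -/
def windExcTo (w : List (ℤ × ℤ)) (i : ℕ) : ℝ :=
  ∑ j ∈ Finset.Icc 2 (min i (w.length - 2)), (ptC (w.getD j 0) / ptC (w.getD (j - 1) 0)).arg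

/-- The full winding angle of an excursion. -/
def windExc (w : List (ℤ × ℤ)) : ℝ := windExcTo w (w.length - 1)

/-- `F^{(α)}(t)`: generating function of excursions with winding angle `α`. -/
def Fgen (t α : ℝ) : ℝ :=
  ∑' w : {w : List (ℤ × ℤ) // IsExcursion w ∧ windExc w = α}, t ^ (w.val.length - 1)

/-- `F(t,b) = Σ_w t^{|w|} e^{i b θ^w}`, the characteristic function of excursions. -/
def Fchar (t b : ℝ) : ℂ :=
  ∑' w : {w : List (ℤ × ℤ) // IsExcursion w},
    (t : ℂ) ^ (w.val.length - 1) * Complex.exp (Complex.I * b * windExc w.val)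

/-- `ψ_k(z) = (1 - √(1-kz²))/(√k z)` (principal square root), `ψ_k(0) = 0`. -/
def psiK (k : ℝ) (z : ℂ) : ℂ :=
  if z = 0 then 0 else (1 - (1 - (k : ℂ) * z ^ 2) ^ ((1 : ℂ) / 2)) / ((Real.sqrt k : ℂ) * z)

/-- `C_n(t)`: the generating function of nonempty simple diagonal walks starting at
`(n,0)` and staying strictly inside the positive quadrant afterwards. -/
def Cgen (t : ℝ) (n : ℕ) : ℝ :=
  ∑' w : {w : List (ℤ × ℤ) // 2 ≤ w.length ∧ w.Chain' IsDiagStep ∧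
      w.head? = some ((n : ℤ), 0) ∧
      ∀ i, 1 ≤ i → i ≤ w.length - 1 → 0 < (w.getD i 0).1 ∧ 0 < (w.getD i 0).2},
    t ^ (w.val.length - 1)

/-- `posCount N n` is the number of `±1` walks of length `N` on `ℤ` from `n` that stay positive
at all times, the start included. -/
def posCount : ℕ → ℕ → ℕ
  | _, 0 => 0
  | 0, _ + 1 => 1
  | N + 1, n + 1 => posCount N (n + 2) + posCount N n

lemma posCount_zero_right (N : ℕ) : posCount N 0 = 0 := by cases N <;> rfl

lemma posCount_le (N n : ℕ) : posCount N n ≤ 2 ^ N := by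
  induction N generalizing n with
  | zero => cases n <;> simp [posCount]
  | succ N ih =>
    cases n with
    | zero => simp [posCount]
    | succ n =>
      have h1 := ih (n + 2)
      have h2 := ih n
      simp only [posCount, pow_succ]
      omega

/-- The four diagonal neighbours of a lattice point. -/
def diagNbrs (p : ℤ × ℤ) : Finset (ℤ × ℤ) :=
  {(p.1 + 1, p.2 + 1), (p.1 + 1, p.2 - 1), (p.1 - 1, p.2 - 1), (p.1 - 1, p.2 + 1)}

lemma mem_diagNbrs {p q : ℤ × ℤ} : q ∈ diagNbrs p ↔ IsDiagStep p q := by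
  obtain ⟨a, b⟩ := p
  obtain ⟨c, d⟩ := q
  simp only [diagNbrs, IsDiagStep, Finset.mem_insert, Finset.mem_singleton, Prod.mk.injEq,
    Prod.mk_sub_mk]
  omega

/-- The diagonal walks of length `N` from `p` that stay in the open positive quadrant after
time `0`. -/
def quadWalks : ℕ → ℤ × ℤ → Finset (List (ℤ × ℤ))
  | 0, p => {[p]}
  | N + 1, p =>
    ((diagNbrs p).filter fun q => 0 < q.1 ∧ 0 < q.2).biUnion
      fun q => (quadWalks N q).image (List.cons p)

lemma mem_quadWalks (N : ℕ) (p : ℤ × ℤ) (w : List (ℤ × ℤ)) :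
    w ∈ quadWalks N p ↔ w.length = N + 1 ∧ w.IsChain IsDiagStep ∧ w.head? = some p ∧
      ∀ i, 1 ≤ i → i ≤ w.length - 1 → 0 < (w.getD i 0).1 ∧ 0 < (w.getD i 0).2 := by
  induction N generalizing p w with
  | zero =>
    simp only [quadWalks, Finset.mem_singleton, zero_add]
    constructor
    · rintro rfl
      refine ⟨rfl, List.isChain_singleton _, rfl, fun i h1 h2 => ?_⟩
      simp at h2
      omega
    · rintro ⟨h1, -, h3, -⟩
      obtain ⟨x, rfl⟩ := List.length_eq_one_iff.1 h1
      simpa using h3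
  | succ N ih =>
    simp only [quadWalks, Finset.mem_biUnion, Finset.mem_filter, Finset.mem_image, mem_diagNbrs, ih]
    constructor
    · rintro ⟨q, ⟨hpq, hq⟩, w', ⟨hl, hc, hh, hpos⟩, rfl⟩
      obtain ⟨u, rfl⟩ : ∃ u, w' = q :: u := by
        cases w' with
        | nil => simp at hh
        | cons x u => exact ⟨u, by simpa using hh⟩
      refine ⟨by simpa using hl, List.isChain_cons_cons.2 ⟨hpq, hc⟩, rfl, fun i h1 h2 => ?_⟩
      obtain ⟨j, rfl⟩ := Nat.exists_eq_add_of_le' h1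
      simp only [List.getD_cons_succ]
      cases j with
      | zero => simpa using hq
      | succ j =>
        refine hpos (j + 1) (by omega) ?_
        simp at h2 ⊢
        omega
    · rintro ⟨hl, hc, hh, hpos⟩
      match w, hl, hc, hh, hpos with
      | [], hl, _, _, _ => simp at hl
      | [_], hl, _, _, _ => simp at hl
      | x :: q :: u, hl, hc, hh, hpos =>
        obtain rfl : x = p := by simpa using hh
        rw [List.isChain_cons_cons] at hc
        refine ⟨q, ⟨hc.1, by simpa using hpos 1 le_rfl (by simp)⟩, q :: u,
          ⟨by simpa using hl, hc.2, rfl, fun i h1 h2 => ?_⟩, rfl⟩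
        have := hpos (i + 1) (by omega) (by simp at h2 ⊢; omega)
        simpa using this

lemma card_quadWalks_succ (N : ℕ) (p : ℤ × ℤ) :
    (quadWalks (N + 1) p).card =
      ∑ q ∈ diagNbrs p, if 0 < q.1 ∧ 0 < q.2 then (quadWalks N q).card else 0 := by
  rw [quadWalks, Finset.card_biUnion, ← Finset.sum_filter]
  · refine Finset.sum_congr rfl fun q _ => Finset.card_image_of_injective _ ?_
    exact List.cons_injective
  · intro q _ r _ hqr
    refine Finset.disjoint_left.2 fun w hw hw' => ?_
    simp only [Finset.mem_image, mem_quadWalks] at hw hw'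
    obtain ⟨u, hu, rfl⟩ := hw
    obtain ⟨u', hu', h⟩ := hw'
    obtain rfl : u' = u := List.cons_injective h
    exact hqr (by simpa [hu.2.2.1] using hu'.2.2.1)

lemma sum_diagNbrs (p : ℤ × ℤ) (g : ℤ × ℤ → ℕ) :
    ∑ q ∈ diagNbrs p, g q = g (p.1 + 1, p.2 + 1) + g (p.1 + 1, p.2 - 1) +
      g (p.1 - 1, p.2 - 1) + g (p.1 - 1, p.2 + 1) := by
  unfold diagNbrs
  rw [Finset.sum_insert, Finset.sum_insert, Finset.sum_insert, Finset.sum_singleton]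
  · ring
  all_goals
    simp only [Finset.mem_insert, Finset.mem_singleton, Prod.mk.injEq]
    omega

lemma card_quadWalks_pos (N x y : ℕ) :
    (if (0 : ℤ) < x ∧ (0 : ℤ) < y then (quadWalks N (x, y)).card else 0) =
      posCount N x * posCount N y := by
  induction N generalizing x y with
  | zero => cases x <;> cases y <;> simp [posCount, quadWalks]
  | succ N ih =>
    cases x with
    | zero => simp [posCount]
    | succ x =>
      cases y with
      | zero => simp [posCount]
      | succ y =>
        rw [if_pos (by constructor <;> positivity), card_quadWalks_succ, sum_diagNbrs]
        have h1 := ih (x + 2) (y + 2)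
        have h2 := ih (x + 2) y
        have h3 := ih x y
        have h4 := ih x (y + 2)
        push_cast at h1 h2 h3 h4 ⊢
        have e : ∀ z : ℤ, z + 1 + 1 = z + 2 := fun z => by ring
        simp only [e, add_sub_cancel_right]
        rw [h1, h2, h3, h4]
        simp only [posCount]
        ring

lemma card_quadWalks_axis (N n : ℕ) :
    (quadWalks (N + 1) ((n + 1 : ℕ), 0)).card =
      (posCount N (n + 2) + posCount N n) * posCount N 1 := by
  rw [card_quadWalks_succ, sum_diagNbrs]
  have h1 := card_quadWalks_pos N (n + 2) 1
  have h2 := card_quadWalks_pos N n 1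
  push_cast at h1 h2 ⊢
  have e : (n : ℤ) + 1 + 1 = n + 2 := by ring
  simp only [e, add_sub_cancel_right]
  rw [h1, h2]
  simp
  ring

lemma posCount_le_real (N n : ℕ) : (posCount N n : ℝ) ≤ 2 ^ N := by
  exact_mod_cast posCount_le N n

lemma hasSum_Cgen {t : ℝ} (ht0 : 0 ≤ t) (ht : t < 1 / 4) (n : ℕ) :
    HasSum (fun N : ℕ => t ^ (N + 1) *
      (((posCount N (n + 2) : ℝ) + posCount N n) * posCount N 1)) (Cgen t (n + 1)) := by
  set S := {w : List (ℤ × ℤ) // 2 ≤ w.length ∧ w.IsChain IsDiagStep ∧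
      w.head? = some (((n + 1 : ℕ) : ℤ), 0) ∧
      ∀ i, 1 ≤ i → i ≤ w.length - 1 → 0 < (w.getD i 0).1 ∧ 0 < (w.getD i 0).2} with hS
  let e : (Σ N : ℕ, quadWalks (N + 1) ((n + 1 : ℕ), 0)) ≃ S :=
    { toFun := fun x => ⟨x.2.1, by
        have := (mem_quadWalks _ _ _).1 x.2.2
        exact ⟨by omega, this.2.1, this.2.2.1, this.2.2.2⟩⟩
      invFun := fun w => ⟨w.1.length - 2, ⟨w.1, (mem_quadWalks _ _ _).2
        ⟨by have := w.2.1; omega, w.2.2.1, w.2.2.2.1, w.2.2.2.2⟩⟩⟩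
      left_inv := by
        rintro ⟨N, w, hw⟩
        have h := ((mem_quadWalks _ _ _).1 hw).1
        have h' : w.length - 2 = N := by omega
        subst h'
        rfl
      right_inv := fun w => rfl }
  have hlen : ∀ x : (Σ N : ℕ, quadWalks (N + 1) (((n + 1 : ℕ) : ℤ), 0)),
      t ^ ((e x).1.length - 1) = t ^ (x.1 + 1) := by
    intro x
    have h := ((mem_quadWalks _ _ _).1 x.2.2).1
    change t ^ (x.2.1.length - 1) = _
    rw [h]
    congr 1
  have hfib : ∀ N : ℕ, HasSum
      (fun _ : quadWalks (N + 1) (((n + 1 : ℕ) : ℤ), 0) => t ^ (N + 1))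
      (t ^ (N + 1) * (((posCount N (n + 2) : ℝ) + posCount N n) * posCount N 1)) := by
    intro N
    have := hasSum_fintype (fun _ : quadWalks (N + 1) (((n + 1 : ℕ) : ℤ), 0) => t ^ (N + 1))
    rw [Finset.sum_const, Finset.card_univ, Fintype.card_coe, card_quadWalks_axis, nsmul_eq_mul,
      mul_comm] at this
    exact_mod_cast this
  have hsum : Summable fun N : ℕ => t ^ (N + 1) *
      (((posCount N (n + 2) : ℝ) + posCount N n) * posCount N 1) := by
    refine Summable.of_nonneg_of_le (fun N => by positivity) (fun N => ?_)
      ((summable_geometric_of_lt_one (r := 4 * t) (by linarith) (by linarith)).mul_left (2 * t))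
    have h1 := posCount_le_real N (n + 2)
    have h2 := posCount_le_real N n
    have h3 := posCount_le_real N 1
    calc _ ≤ t ^ (N + 1) * ((2 ^ N + 2 ^ N) * 2 ^ N) := by gcongr
      _ = 2 * t * (4 * t) ^ N := by
        rw [mul_pow, pow_succ, show (4 : ℝ) = 2 * 2 by norm_num, mul_pow]; ring
  have hsig : Summable fun x : (Σ N : ℕ, quadWalks (N + 1) (((n + 1 : ℕ) : ℤ), 0)) =>
      t ^ ((e x).1.length - 1) := by
    simp only [hlen]
    rw [summable_sigma_of_nonneg fun _ => by positivity]
    refine ⟨fun N => (hfib N).summable, ?_⟩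
    simpa only [(hfib _).tsum_eq] using hsum
  have hS' := hsig.hasSum
  have h1 : HasSum (fun N : ℕ => t ^ (N + 1) *
      (((posCount N (n + 2) : ℝ) + posCount N n) * posCount N 1))
      (∑' x, t ^ ((e x).1.length - 1)) := by
    refine hS'.sigma fun N => ?_
    simpa only [hlen] using hfib N
  rw [e.tsum_eq (fun w : S => t ^ (w.1.length - 1))] at h1
  exact h1

lemma two_abs_div_one_add_sq_lt {l : ℝ} (hl : |l| < 1) : 2 * |l / (1 + l ^ 2)| < 1 := by
  have h : 0 < 1 + l ^ 2 := by positivity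
  rw [abs_div, abs_of_pos h, ← mul_div_assoc, div_lt_one h]
  nlinarith [sq_abs l]

lemma summable_posCount {x : ℝ} (hx : 2 * |x| < 1) (n : ℕ) :
    Summable fun N : ℕ => (posCount N n : ℝ) * x ^ N := by
  refine Summable.of_norm_bounded (summable_geometric_of_lt_one (by positivity) hx) fun N => ?_
  rw [norm_mul, norm_pow, Real.norm_eq_abs x, mul_pow, Real.norm_of_nonneg (by positivity)]
  gcongr
  exact posCount_le_real N n

lemma hasSum_posCount {l : ℝ} (hl : |l| < 1) (n : ℕ) :
    HasSum (fun N : ℕ => (posCount N n : ℝ) * (l / (1 + l ^ 2)) ^ N)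
      ((1 - l ^ n) / (1 - 2 * (l / (1 + l ^ 2)))) := by
  set x := l / (1 + l ^ 2) with hx
  have hx1 : 2 * |x| < 1 := two_abs_div_one_add_sq_lt hl
  have hs := summable_posCount hx1
  have hx2 : 0 < 1 - 2 * x := by linarith [le_abs_self x]
  have hxl : x * (1 + l ^ 2) = l := div_mul_cancel₀ _ (by positivity)
  clear_value x
  set G : ℕ → ℝ := fun n => ∑' N : ℕ, (posCount N n : ℝ) * x ^ N with hG
  set H : ℕ → ℝ := fun n => G n - (1 - l ^ n) / (1 - 2 * x) with hH
  have hG0 : G 0 = 0 := by simp [hG, posCount_zero_right]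
  have hG1 : ∀ n, G (n + 1) = 1 + x * (G (n + 2) + G n) := by
    intro n
    simp only [hG]
    rw [(hs (n + 1)).tsum_eq_zero_add, ← (hs (n + 2)).tsum_add (hs n), ← tsum_mul_left]
    congr 1
    · simp [posCount]
    · refine tsum_congr fun N => ?_
      simp only [posCount]
      push_cast
      ring
  have hH0 : H 0 = 0 := by simp [hH, hG0]
  have hH1 : ∀ n, H (n + 1) = x * (H (n + 2) + H n) := by
    intro n
    simp only [hH]
    rw [hG1]
    have hu : (1 - 2 * x)⁻¹ * (1 - 2 * x) = 1 := inv_mul_cancel₀ hx2.ne'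
    simp only [div_eq_mul_inv]
    linear_combination -hu - (1 - 2 * x)⁻¹ * l ^ n * hxl
  have hGb : ∀ n, |G n| ≤ (1 - 2 * |x|)⁻¹ := by
    intro n
    rw [← Real.norm_eq_abs]
    refine tsum_of_norm_bounded (hasSum_geometric_of_lt_one (by positivity) hx1) fun N => ?_
    rw [norm_mul, norm_pow, Real.norm_eq_abs x, mul_pow, Real.norm_of_nonneg (by positivity)]
    gcongr
    exact posCount_le_real N n
  obtain ⟨M, hM⟩ : ∃ M, ∀ n, |H n| ≤ M := by
    refine ⟨(1 - 2 * |x|)⁻¹ + 2 / (1 - 2 * x), fun n => (abs_sub _ _).trans (add_le_add (hGb n) ?_)⟩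
    rw [abs_div, abs_of_pos hx2]
    gcongr
    have : |l ^ n| ≤ 1 := by rw [abs_pow]; exact pow_le_one₀ (abs_nonneg _) hl.le
    rw [abs_le] at this ⊢
    constructor <;> linarith
  have hM' : ∀ j n, |H n| ≤ (2 * |x|) ^ j * M := by
    intro j
    induction j with
    | zero => simpa using hM
    | succ j ih =>
      intro n
      cases n with
      | zero =>
        have := (abs_nonneg (H 0)).trans (hM 0)
        rw [hH0, abs_zero]
        positivity
      | succ n =>
        rw [hH1, abs_mul]
        calc |x| * |H (n + 2) + H n| ≤ |x| * (|H (n + 2)| + |H n|) := by gcongr; exact abs_add_le _ _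
          _ ≤ |x| * ((2 * |x|) ^ j * M + (2 * |x|) ^ j * M) := by gcongr <;> apply ih
          _ = _ := by ring
  have hz : H n = 0 := by
    have ht := (tendsto_pow_atTop_nhds_zero_of_lt_one (by positivity) hx1).mul_const M
    rw [zero_mul] at ht
    have := ge_of_tendsto' ht fun j => hM' j n
    exact abs_nonpos_iff.1 this
  rw [show (1 - l ^ n) / (1 - 2 * x) = G n by simp only [hH] at hz; linarith]
  exact (hs n).hasSum

/-- The trigonometric polynomial `sin (n θ) cot (θ / 2)`. -/
def cotKer (n : ℕ) (θ : ℝ) : ℝ :=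
  ∑ j ∈ Finset.range n, (Real.cos (j * θ) + Real.cos ((j + 1) * θ))

lemma continuous_cotKer (n : ℕ) : Continuous (cotKer n) := by
  unfold cotKer
  fun_prop

lemma abs_cotKer_le (n : ℕ) (θ : ℝ) : |cotKer n θ| ≤ 2 * n := by
  unfold cotKer
  refine (Finset.abs_sum_le_sum_abs _ _).trans ?_
  refine (Finset.sum_le_card_nsmul _ _ 2 fun j _ => ?_).trans (by simp [mul_comm])
  exact (abs_add_le _ _).trans (by
    linarith [Real.abs_cos_le_one (j * θ), Real.abs_cos_le_one ((j + 1) * θ)])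

lemma cotKer_one (θ : ℝ) : cotKer 1 θ = 1 + Real.cos θ := by simp [cotKer]

lemma cotKer_mul_sin (n : ℕ) (θ : ℝ) :
    cotKer n θ * Real.sin θ = Real.sin (n * θ) * (1 + Real.cos θ) := by
  induction n with
  | zero => simp [cotKer]
  | succ n ih =>
    rw [cotKer, Finset.sum_range_succ, ← cotKer, add_mul, ih]
    push_cast
    rw [add_mul (n : ℝ), one_mul, Real.sin_add, Real.cos_add]
    linear_combination (-Real.sin (n * θ)) * Real.sin_sq_add_cos_sq θ

lemma cotKer_add_two (n : ℕ) (θ : ℝ) :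
    cotKer (n + 2) θ + cotKer n θ = 2 * Real.cos θ * cotKer (n + 1) θ := by
  induction n with
  | zero =>
    simp only [cotKer, Finset.sum_range_succ, Finset.sum_range_zero]
    norm_num
    rw [Real.cos_two_mul]
    ring
  | succ n ih =>
    have e1 : cotKer (n + 1 + 2) θ = cotKer (n + 2) θ +
        (Real.cos ((n + 2 : ℕ) * θ) + Real.cos (((n + 2 : ℕ) + 1) * θ)) := by
      rw [cotKer, Finset.sum_range_succ, ← cotKer]
    have e2 : cotKer (n + 1 + 1) θ = cotKer (n + 1) θ +
        (Real.cos ((n + 1 : ℕ) * θ) + Real.cos (((n + 1 : ℕ) + 1) * θ)) := by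
      rw [cotKer, Finset.sum_range_succ, ← cotKer]
    have e3 : cotKer (n + 1) θ = cotKer n θ +
        (Real.cos (n * θ) + Real.cos ((n + 1) * θ)) := by
      rw [cotKer, Finset.sum_range_succ, ← cotKer]
    have t1 : Real.cos ((n + 2 : ℕ) * θ) + Real.cos (n * θ) =
        2 * Real.cos θ * Real.cos ((n + 1 : ℕ) * θ) := by
      have := Real.two_mul_cos_mul_cos ((n + 1 : ℕ) * θ) θ
      push_cast at this ⊢
      rw [show ((n : ℝ) + 2) * θ = (n + 1) * θ + θ by ring,
        show (n : ℝ) * θ = (n + 1) * θ - θ by ring]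
      linarith
    have t2 : Real.cos (((n + 2 : ℕ) + 1) * θ) + Real.cos ((n + 1) * θ) =
        2 * Real.cos θ * Real.cos (((n + 1 : ℕ) + 1) * θ) := by
      have := Real.two_mul_cos_mul_cos (((n + 1 : ℕ) + 1) * θ) θ
      push_cast at this ⊢
      rw [show ((n : ℝ) + 2 + 1) * θ = (n + 1 + 1) * θ + θ by ring,
        show ((n : ℝ) + 1) * θ = (n + 1 + 1) * θ - θ by ring]
      ring_nf at this ⊢
      linarith
    linear_combination e1 - 2 * Real.cos θ * e2 + e3 + ih + t1 + t2

lemma integral_cos_nat_mul (j : ℕ) :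
    ∫ θ in (0 : ℝ)..π, Real.cos (((j : ℝ) + 1) * θ) = 0 := by
  have hj : ((j : ℝ) + 1) ≠ 0 := by positivity
  rw [intervalIntegral.integral_comp_mul_left (fun x => Real.cos x) hj, integral_cos]
  have := Real.sin_nat_mul_pi (j + 1)
  push_cast at this
  simp [this]

lemma integral_cotKer (n : ℕ) : ∫ θ in (0 : ℝ)..π, cotKer (n + 1) θ = π := by
  induction n with
  | zero =>
    have h := integral_cos_nat_mul 0
    simp only [Nat.cast_zero, zero_add, one_mul] at h
    simp only [zero_add, cotKer_one]
    rw [intervalIntegral.integral_add (by simp) (Real.continuous_cos.intervalIntegrable _ _), h]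
    simp
  | succ n ih =>
    have : ∀ θ, cotKer (n + 1 + 1) θ = cotKer (n + 1) θ +
        (Real.cos (((n : ℝ) + 1) * θ) + Real.cos (((n + 1 : ℕ) + 1 : ℝ) * θ)) := by
      intro θ
      rw [cotKer, Finset.sum_range_succ, ← cotKer]
      push_cast
      rfl
    simp only [this]
    rw [intervalIntegral.integral_add ((continuous_cotKer _).intervalIntegrable _ _)
      (Continuous.intervalIntegrable (by fun_prop) _ _),
      intervalIntegral.integral_add (Continuous.intervalIntegrable (by fun_prop) _ _)
      (Continuous.intervalIntegrable (by fun_prop) _ _), ih, integral_cos_nat_mul,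
      integral_cos_nat_mul]
    ring

lemma integral_two_cos_pow_mul_cotKer (N n : ℕ) :
    ∫ θ in (0 : ℝ)..π, (2 * Real.cos θ) ^ N * cotKer n θ = π * posCount N n := by
  have hi : ∀ N n, IntervalIntegrable (fun θ => (2 * Real.cos θ) ^ N * cotKer n θ)
      MeasureTheory.volume 0 π := fun N n =>
    Continuous.intervalIntegrable (by have := continuous_cotKer n; fun_prop) _ _
  induction N generalizing n with
  | zero =>
    cases n with
    | zero => simp [cotKer, posCount]
    | succ n => simp [integral_cotKer, posCount]
  | succ N ih =>
    cases n with
    | zero => simp [cotKer, posCount]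
    | succ n =>
      have : ∀ θ, (2 * Real.cos θ) ^ (N + 1) * cotKer (n + 1) θ =
          (2 * Real.cos θ) ^ N * cotKer (n + 2) θ + (2 * Real.cos θ) ^ N * cotKer n θ := by
        intro θ
        rw [← mul_add, cotKer_add_two]
        ring
      simp only [this]
      rw [intervalIntegral.integral_add (hi _ _) (hi _ _), ih, ih, posCount]
      push_cast
      ring

lemma hasSum_integral_mul_of_summable {g : ℝ → ℝ} (hg : Continuous g) {h : ℕ → ℝ → ℝ}
    (hh : ∀ n, Continuous (h n)) {u : ℕ → ℝ} (hu : Summable u) (hb : ∀ n θ, |h n θ| ≤ u n)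
    (a b : ℝ) :
    HasSum (fun n => ∫ θ in a..b, g θ * h n θ) (∫ θ in a..b, g θ * ∑' n, h n θ) := by
  refine intervalIntegral.hasSum_integral_of_dominated_convergence (fun n θ => |g θ| * u n)
    (fun n => (hg.mul (hh n)).aestronglyMeasurable) (fun n => ?_) ?_ ?_ ?_
  · refine Filter.Eventually.of_forall fun θ _ => ?_
    rw [norm_mul, Real.norm_eq_abs, Real.norm_eq_abs]
    exact mul_le_mul_of_nonneg_left (hb n θ) (abs_nonneg _)
  · exact Filter.Eventually.of_forall fun θ _ => hu.mul_left _
  · simp only [tsum_mul_left]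
    exact (hg.abs.mul continuous_const).intervalIntegrable _ _
  · refine Filter.Eventually.of_forall fun θ _ => HasSum.mul_left _ ?_
    exact (Summable.of_norm_bounded hu fun n => hb n θ).hasSum

/-- The root `l ∈ (-1, 1)` of `2 l = k cos φ (1 + l²)`. -/
def lamFun (k φ : ℝ) : ℝ := k * Real.cos φ / (1 + Real.sqrt (1 - k ^ 2 * Real.cos φ ^ 2))

lemma continuous_lamFun (k : ℝ) : Continuous (lamFun k) := by
  unfold lamFun
  refine Continuous.div (by fun_prop) (by fun_prop) fun φ => ?_
  have := Real.sqrt_nonneg (1 - k ^ 2 * Real.cos φ ^ 2)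
  positivity

section lam

variable {k : ℝ} (hk : k ∈ Ioo (0 : ℝ) 1)
include hk

lemma delta_pos (φ : ℝ) : 0 < 1 - k ^ 2 * Real.cos φ ^ 2 := by
  have h1 : k ^ 2 < 1 := by nlinarith [hk.1, hk.2]
  nlinarith [Real.cos_sq_le_one φ, sq_nonneg (Real.cos φ)]

lemma one_sub_mul_cos_pos (φ : ℝ) : 0 < 1 - k * Real.cos φ := by
  nlinarith [hk.1, hk.2, Real.cos_le_one φ]

lemma abs_lamFun_lt (φ : ℝ) : |lamFun k φ| < 1 := by
  have h := Real.sqrt_pos.2 (delta_pos hk φ)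
  have h1 : |k * Real.cos φ| < 1 := by
    rw [abs_mul, abs_of_pos hk.1]
    nlinarith [hk.1, hk.2, Real.abs_cos_le_one φ]
  rw [lamFun, abs_div, abs_of_pos (by positivity : 0 < 1 + √(1 - k ^ 2 * Real.cos φ ^ 2)),
    div_lt_one (by positivity)]
  linarith

lemma one_add_lamFun_sq (φ : ℝ) :
    1 + lamFun k φ ^ 2 = 2 / (1 + √(1 - k ^ 2 * Real.cos φ ^ 2)) := by
  have h := Real.sqrt_pos.2 (delta_pos hk φ)
  have h2 := Real.sq_sqrt (delta_pos hk φ).le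
  rw [lamFun]
  set r := √(1 - k ^ 2 * Real.cos φ ^ 2)
  field_simp
  linear_combination h2

lemma lamFun_div (φ : ℝ) :
    lamFun k φ / (1 + lamFun k φ ^ 2) = k / 2 * Real.cos φ := by
  have h := Real.sqrt_pos.2 (delta_pos hk φ)
  rw [one_add_lamFun_sq hk, lamFun]
  field_simp

lemma hasSum_posCount_cos (n : ℕ) (φ : ℝ) :
    HasSum (fun N : ℕ => (posCount N n : ℝ) * (k / 2 * Real.cos φ) ^ N)
      ((1 - lamFun k φ ^ n) / (1 - k * Real.cos φ)) := by
  have h := hasSum_posCount (abs_lamFun_lt hk φ) n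
  rw [lamFun_div hk, show 2 * (k / 2 * Real.cos φ) = k * Real.cos φ by ring] at h
  exact h

lemma half_add_posCount_series (φ : ℝ) :
    1 / 2 + k / 2 * Real.cos φ * ((1 - lamFun k φ) / (1 - k * Real.cos φ)) =
      1 / 2 * ((1 + lamFun k φ) / (1 - lamFun k φ)) := by
  have h1 := abs_lt.1 (abs_lamFun_lt hk φ)
  have h2 : k * Real.cos φ = 2 * (lamFun k φ / (1 + lamFun k φ ^ 2)) := by
    rw [lamFun_div hk]; ring
  rw [show k / 2 * Real.cos φ = k * Real.cos φ / 2 by ring, h2]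
  set l := lamFun k φ
  have h3 : 1 - l ≠ 0 := by linarith
  have h4 : 1 - 2 * (l / (1 + l ^ 2)) = (1 - l) ^ 2 / (1 + l ^ 2) := by field_simp; ring
  rw [h4]
  field_simp
  ring

lemma half_add_Cgen_eq_integral_cotKer (n : ℕ) :
    π * (1 / 2 + Cgen (k / 4) (n + 1)) = ∫ θ in (0 : ℝ)..π,
      cotKer (n + 1) θ * (1 / 2 * ((1 + lamFun k θ) / (1 - lamFun k θ))) := by
  have hC := (hasSum_Cgen (t := k / 4) (by linarith [hk.1]) (by linarith [hk.2]) n).mul_left π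
  have hS := hasSum_integral_mul_of_summable (continuous_cotKer (n + 1))
    (h := fun N θ => k / 2 * Real.cos θ * ((posCount N 1 : ℝ) * (k / 2 * Real.cos θ) ^ N))
    (u := fun N => k ^ N) (fun N => by fun_prop)
    (summable_geometric_of_lt_one hk.1.le hk.2) (fun N θ => ?_) 0 π
  · have hterm : ∀ N : ℕ, ∫ θ in (0 : ℝ)..π, cotKer (n + 1) θ *
        (k / 2 * Real.cos θ * ((posCount N 1 : ℝ) * (k / 2 * Real.cos θ) ^ N)) =
        π * ((k / 4) ^ (N + 1) *
          (((posCount N (n + 2) : ℝ) + posCount N n) * posCount N 1)) := by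
      intro N
      have h := integral_two_cos_pow_mul_cotKer (N + 1) (n + 1)
      have e : ∀ θ, cotKer (n + 1) θ *
        (k / 2 * Real.cos θ * ((posCount N 1 : ℝ) * (k / 2 * Real.cos θ) ^ N)) =
        ((k / 4) ^ (N + 1) * posCount N 1) * ((2 * Real.cos θ) ^ (N + 1) * cotKer (n + 1) θ) := by
        intro θ
        rw [show k / 2 * Real.cos θ = k / 4 * (2 * Real.cos θ) by ring, mul_pow, pow_succ, pow_succ]
        ring
      simp only [e]
      rw [intervalIntegral.integral_const_mul, h, posCount]
      push_cast
      ring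
    simp only [hterm] at hS
    have hU := hC.unique hS
    rw [mul_add, hU]
    have e : ∀ θ, cotKer (n + 1) θ * (1 / 2 * ((1 + lamFun k θ) / (1 - lamFun k θ))) =
        1 / 2 * cotKer (n + 1) θ + cotKer (n + 1) θ * ∑' N : ℕ,
          k / 2 * Real.cos θ * ((posCount N 1 : ℝ) * (k / 2 * Real.cos θ) ^ N) := by
      intro θ
      rw [tsum_mul_left, (hasSum_posCount_cos hk 1 θ).tsum_eq, ← half_add_posCount_series hk, pow_one]
      ring
    have e' : ∀ θ, cotKer (n + 1) θ * ∑' N : ℕ,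
          k / 2 * Real.cos θ * ((posCount N 1 : ℝ) * (k / 2 * Real.cos θ) ^ N) =
        cotKer (n + 1) θ * (k / 2 * Real.cos θ * ((1 - lamFun k θ) / (1 - k * Real.cos θ))) := by
      intro θ
      rw [tsum_mul_left, (hasSum_posCount_cos hk 1 θ).tsum_eq, pow_one]
    simp only [e]
    rw [intervalIntegral.integral_add, intervalIntegral.integral_const_mul, integral_cotKer]
    · ring
    · exact ((continuous_cotKer _).const_mul _).intervalIntegrable _ _
    · simp only [e']
      have := continuous_cotKer (n + 1)
      have := continuous_lamFun k
      refine Continuous.intervalIntegrable (Continuous.mul (by fun_prop) (Continuous.mul (by fun_prop)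
        (Continuous.div (by fun_prop) (by fun_prop) fun θ => (one_sub_mul_cos_pos hk θ).ne'))) _ _
  · have h1 := posCount_le_real N 1
    have h2 := Real.abs_cos_le_one θ
    have hk0 := hk.1
    have hk1 := hk.2
    have h3 : |k / 2 * Real.cos θ| ≤ k / 2 := by
      rw [abs_mul, abs_of_pos (by positivity)]
      nlinarith
    rw [abs_mul (k / 2 * Real.cos θ), abs_mul (posCount N 1 : ℝ), abs_pow, Nat.abs_cast]
    calc |k / 2 * Real.cos θ| * (posCount N 1 * |k / 2 * Real.cos θ| ^ N)
        ≤ 1 * (2 ^ N * (k / 2) ^ N) := by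
          gcongr
          linarith
      _ = k ^ N := by rw [← mul_pow]; ring

lemma Cgen_eq_integral_lamFun (n : ℕ) :
    π * Cgen (k / 4) (n + 1) = ∫ φ in (0 : ℝ)..π,
      (1 + Real.cos φ) * (k / 4 * ((2 - (1 + lamFun k φ ^ 2) * lamFun k φ ^ n) /
        (1 - k * Real.cos φ))) := by
  have hC := (hasSum_Cgen (t := k / 4) (by linarith [hk.1]) (by linarith [hk.2]) n).mul_left π
  have hS := hasSum_integral_mul_of_summable (g := fun φ => 1 + Real.cos φ) (by fun_prop)
    (h := fun N φ => k / 4 * ((posCount N (n + 2) : ℝ) * (k / 2 * Real.cos φ) ^ N +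
      (posCount N n : ℝ) * (k / 2 * Real.cos φ) ^ N))
    (u := fun N => k ^ N) (fun N => by fun_prop)
    (summable_geometric_of_lt_one hk.1.le hk.2) (fun N θ => ?_) 0 π
  · have hterm : ∀ N : ℕ, ∫ φ in (0 : ℝ)..π, (1 + Real.cos φ) *
        (k / 4 * ((posCount N (n + 2) : ℝ) * (k / 2 * Real.cos φ) ^ N +
          (posCount N n : ℝ) * (k / 2 * Real.cos φ) ^ N)) =
        π * ((k / 4) ^ (N + 1) *
          (((posCount N (n + 2) : ℝ) + posCount N n) * posCount N 1)) := by
      intro N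
      have h := integral_two_cos_pow_mul_cotKer N 1
      have e : ∀ φ, (1 + Real.cos φ) *
        (k / 4 * ((posCount N (n + 2) : ℝ) * (k / 2 * Real.cos φ) ^ N +
          (posCount N n : ℝ) * (k / 2 * Real.cos φ) ^ N)) =
        ((k / 4) ^ (N + 1) * ((posCount N (n + 2) : ℝ) + posCount N n)) *
          ((2 * Real.cos φ) ^ N * cotKer 1 φ) := by
        intro θ
        rw [show k / 2 * Real.cos θ = k / 4 * (2 * Real.cos θ) by ring, mul_pow, pow_succ,
          cotKer_one]
        ring
      simp only [e]
      rw [intervalIntegral.integral_const_mul, h]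
      ring
    simp only [hterm] at hS
    rw [hC.unique hS]
    congr 1
    ext φ
    have h1 := hasSum_posCount_cos hk (n + 2) φ
    have h2 := hasSum_posCount_cos hk n φ
    rw [tsum_mul_left, (h1.add h2).tsum_eq]
    ring
  · have h1 := posCount_le_real N (n + 2)
    have h1' := posCount_le_real N n
    have h2 := Real.abs_cos_le_one θ
    have hk0 := hk.1
    have hk1 := hk.2
    have h3 : |k / 2 * Real.cos θ| ≤ k / 2 := by
      rw [abs_mul, abs_of_pos (by positivity)]
      nlinarith
    rw [← add_mul, abs_mul, abs_mul, abs_pow, abs_of_pos (by positivity : 0 < k / 4),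
      abs_of_nonneg (by positivity : 0 ≤ (posCount N (n + 2) : ℝ) + posCount N n)]
    calc k / 4 * ((posCount N (n + 2) + posCount N n) * |k / 2 * Real.cos θ| ^ N)
        ≤ 1 / 2 * ((2 ^ N + 2 ^ N) * (k / 2) ^ N) := by
          gcongr
          linarith
      _ = k ^ N := by rw [← two_mul, ← mul_assoc, ← mul_assoc, div_mul_cancel₀ _ (by norm_num),
                        one_mul, ← mul_pow, mul_div_cancel₀ _ (by norm_num)]

lemma half_add_integral_eq :
    π / 2 + ∫ φ in (0 : ℝ)..π, (1 + Real.cos φ) * (k / 4 * (2 / (1 - k * Real.cos φ))) =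
      π / 2 * ((1 + lamFun k 0) / (1 - lamFun k 0)) := by
  have hS := hasSum_integral_mul_of_summable (g := fun φ => 1 + Real.cos φ) (by fun_prop)
    (h := fun N φ => k / 2 * (k * Real.cos φ) ^ N)
    (u := fun N => k ^ N) (fun N => by fun_prop)
    (summable_geometric_of_lt_one hk.1.le hk.2) (fun N θ => ?_) 0 π
  · have hterm : ∀ N : ℕ, ∫ φ in (0 : ℝ)..π, (1 + Real.cos φ) *
        (k / 2 * (k * Real.cos φ) ^ N) =
        π * (k / 2 * ((posCount N 1 : ℝ) * (k / 2 * Real.cos 0) ^ N)) := by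
      intro N
      have h := integral_two_cos_pow_mul_cotKer N 1
      have e : ∀ φ, (1 + Real.cos φ) * (k / 2 * (k * Real.cos φ) ^ N) =
          (k / 2 * (k / 2) ^ N) * ((2 * Real.cos φ) ^ N * cotKer 1 φ) := by
        intro θ
        rw [show k * Real.cos θ = k / 2 * (2 * Real.cos θ) by ring, mul_pow, cotKer_one]
        ring
      simp only [e]
      rw [intervalIntegral.integral_const_mul, h, Real.cos_zero]
      ring
    simp only [hterm] at hS
    have hU := (((hasSum_posCount_cos hk 1 0).mul_left (k / 2)).mul_left π).unique hS
    have e : ∀ φ, (1 + Real.cos φ) * (k / 4 * (2 / (1 - k * Real.cos φ))) =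
        (1 + Real.cos φ) * ∑' N : ℕ, k / 2 * (k * Real.cos φ) ^ N := by
      intro φ
      have h3 : |k * Real.cos φ| < 1 := by
        rw [abs_mul, abs_of_pos hk.1]
        nlinarith [hk.1, hk.2, Real.abs_cos_le_one φ]
      rw [tsum_mul_left, tsum_geometric_of_abs_lt_one h3]
      ring
    simp only [e]
    rw [← hU]
    have := half_add_posCount_series hk 0
    rw [pow_one]
    simp only [Real.cos_zero, mul_one] at this ⊢
    linear_combination π * this
  · have h2 := Real.abs_cos_le_one θ
    have hk0 := hk.1
    have hk1 := hk.2
    have h3 : |k * Real.cos θ| ≤ k := by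
      rw [abs_mul, abs_of_pos (by positivity)]
      nlinarith
    rw [abs_mul, abs_pow, abs_of_pos (by positivity : 0 < k / 2)]
    calc k / 2 * |k * Real.cos θ| ^ N ≤ 1 * k ^ N := by
          gcongr
          linarith
      _ = k ^ N := one_mul _

end lam

lemma hasSum_half_add_Cgen {k : ℝ} (hk : k ∈ Ioo (0 : ℝ) 1) {b : ℕ → ℝ}
    (hb : Summable fun n : ℕ => |b n| * (n + 1)) :
    HasSum (fun n => b n * (π * (1 / 2 + Cgen (k / 4) (n + 1))))
      (∫ θ in (0 : ℝ)..π, 1 / 2 * ((1 + lamFun k θ) / (1 - lamFun k θ)) *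
        ∑' n, b n * cotKer (n + 1) θ) := by
  have hc : Continuous fun θ => 1 / 2 * ((1 + lamFun k θ) / (1 - lamFun k θ)) := by
    have := continuous_lamFun k
    refine Continuous.mul continuous_const (Continuous.div (by fun_prop) (by fun_prop) fun θ => ?_)
    linarith [abs_lt.1 (abs_lamFun_lt hk θ)]
  have hS := hasSum_integral_mul_of_summable hc (h := fun n θ => b n * cotKer (n + 1) θ)
    (u := fun n => |b n| * (n + 1) * 2)
    (fun n => by have := continuous_cotKer (n + 1); fun_prop) (hb.mul_right 2) (fun n θ => ?_) 0 π
  · convert hS using 2 with n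
    rw [half_add_Cgen_eq_integral_cotKer hk, ← intervalIntegral.integral_const_mul]
    congr 1
    ext θ
    ring
  · have := abs_cotKer_le (n + 1) θ
    rw [abs_mul, mul_assoc]
    gcongr
    push_cast at this
    linarith

lemma tsum_half_add_Cgen {k : ℝ} (hk : k ∈ Ioo (0 : ℝ) 1) {b : ℕ → ℝ}
    (hb : Summable fun n : ℕ => |b n| * (n + 1)) :
    ∑' n, b n * (π * (1 / 2 + Cgen (k / 4) (n + 1))) =
      π / 2 * ((1 + lamFun k 0) / (1 - lamFun k 0)) * ∑' n, b n -
      ∫ φ in (0 : ℝ)..π, (1 + Real.cos φ) * (k / 4 * ((1 + lamFun k φ ^ 2) /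
        (1 - k * Real.cos φ))) * ∑' n, b n * lamFun k φ ^ n := by
  have hl := continuous_lamFun k
  have hd : ∀ φ, 1 - k * Real.cos φ ≠ 0 := fun φ => (one_sub_mul_cos_pos hk φ).ne'
  have hc : Continuous fun φ => (1 + Real.cos φ) * (k / 4 * ((1 + lamFun k φ ^ 2) /
        (1 - k * Real.cos φ))) :=
    Continuous.mul (by fun_prop) (Continuous.mul (by fun_prop)
      (Continuous.div (by fun_prop) (by fun_prop) hd))
  have hc' : Continuous fun φ => (1 + Real.cos φ) * (k / 4 * (2 / (1 - k * Real.cos φ))) :=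
    Continuous.mul (by fun_prop) (Continuous.mul (by fun_prop)
      (Continuous.div (by fun_prop) (by fun_prop) hd))
  have hb' : Summable fun n => |b n| := by
    refine Summable.of_nonneg_of_le (fun n => abs_nonneg _) (fun n => ?_) hb
    nlinarith [abs_nonneg (b n), (n.cast_nonneg : (0 : ℝ) ≤ n)]
  have hS := hasSum_integral_mul_of_summable hc (h := fun n φ => b n * lamFun k φ ^ n)
    (u := fun n => |b n|) (fun n => by fun_prop) hb' (fun n φ => ?_) 0 π
  · have hT := (hb'.of_abs.hasSum.mul_left (π / 2 * ((1 + lamFun k 0) / (1 - lamFun k 0)))).sub hS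
    rw [← hT.tsum_eq]
    refine tsum_congr fun n => ?_
    rw [mul_add π, Cgen_eq_integral_lamFun hk, ← half_add_integral_eq hk]
    have e : ∀ φ, (1 + Real.cos φ) * (k / 4 * ((2 - (1 + lamFun k φ ^ 2) * lamFun k φ ^ n) /
        (1 - k * Real.cos φ))) = (1 + Real.cos φ) * (k / 4 * (2 / (1 - k * Real.cos φ))) -
        (1 + Real.cos φ) * (k / 4 * ((1 + lamFun k φ ^ 2) /
          (1 - k * Real.cos φ))) * lamFun k φ ^ n := by
      intro φ
      ring
    have e' : ∀ φ, (1 + Real.cos φ) * (k / 4 * ((1 + lamFun k φ ^ 2) /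
        (1 - k * Real.cos φ))) * (b n * lamFun k φ ^ n) =
        b n * ((1 + Real.cos φ) * (k / 4 * ((1 + lamFun k φ ^ 2) /
          (1 - k * Real.cos φ))) * lamFun k φ ^ n) := by
      intro φ
      ring
    simp only [e, e']
    have hi : Continuous fun φ => (1 + Real.cos φ) * (k / 4 * ((1 + lamFun k φ ^ 2) /
        (1 - k * Real.cos φ))) * lamFun k φ ^ n := hc.mul (hl.pow n)
    rw [intervalIntegral.integral_sub (hc'.intervalIntegrable _ _)
      (hi.intervalIntegrable _ _), intervalIntegral.integral_const_mul]
    ring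
  · rw [abs_mul, abs_pow]
    exact mul_le_of_le_one_right (abs_nonneg _)
      (pow_le_one₀ (abs_nonneg _) (abs_lamFun_lt hk φ).le)

section elliptic

variable {k : ℝ} (hk : k ∈ Ioo (0 : ℝ) 1)
include hk

lemma one_sub_sq_mul_sin_sq_pos (θ : ℝ) : 0 < 1 - k ^ 2 * Real.sin θ ^ 2 := by
  have h1 : k ^ 2 < 1 := by nlinarith [hk.1, hk.2]
  nlinarith [Real.sin_sq_le_one θ, sq_nonneg (Real.sin θ)]

lemma Kell_eq_integral_sin :
    Kell k = ∫ θ in (0 : ℝ)..(π / 2), 1 / √(1 - k ^ 2 * Real.sin θ ^ 2) := by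
  have hpi := Real.pi_pos
  rw [Kell, intervalIntegral.integral_of_le zero_le_one, intervalIntegral.integral_of_le (by positivity),
    MeasureTheory.integral_Ioc_eq_integral_Ioo, MeasureTheory.integral_Ioc_eq_integral_Ioo]
  have himg : Real.sin '' Ioo 0 (π / 2) = Ioo 0 1 := by
    ext y
    constructor
    · rintro ⟨θ, ⟨h1, h2⟩, rfl⟩
      refine ⟨Real.sin_pos_of_pos_of_lt_pi h1 (by linarith), ?_⟩
      rw [← Real.sin_pi_div_two]
      exact Real.sin_lt_sin_of_lt_of_le_pi_div_two (by linarith) le_rfl h2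
    · rintro ⟨h1, h2⟩
      exact ⟨Real.arcsin y, ⟨Real.arcsin_pos.2 h1, Real.arcsin_lt_pi_div_two.2 h2⟩,
        Real.sin_arcsin (by linarith) h2.le⟩
  rw [← himg, MeasureTheory.integral_image_eq_integral_abs_deriv_smul measurableSet_Ioo
    (fun θ _ => (Real.hasDerivAt_sin θ).hasDerivWithinAt)
    (Real.injOn_sin.mono fun θ (hθ : θ ∈ Ioo 0 (π / 2)) => (⟨by linarith [hθ.1], hθ.2.le⟩ :
      θ ∈ Icc (-(π / 2)) (π / 2)))]
  refine MeasureTheory.setIntegral_congr_fun measurableSet_Ioo fun θ hθ => ?_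
  have hc : 0 < Real.cos θ := Real.cos_pos_of_mem_Ioo ⟨by linarith [hθ.1], hθ.2⟩
  have hs : 1 - Real.sin θ ^ 2 = Real.cos θ ^ 2 := by linarith [Real.sin_sq_add_cos_sq θ]
  have hD := Real.sqrt_pos.2 (one_sub_sq_mul_sin_sq_pos hk θ)
  simp only [smul_eq_mul]
  rw [hs, Real.sqrt_mul (sq_nonneg _), Real.sqrt_sq hc.le, abs_of_pos hc]
  field_simp

lemma Kell_pos : 0 < Kell k := by
  rw [Kell_eq_integral_sin hk]
  have h := fun θ => Real.sqrt_pos.2 (one_sub_sq_mul_sin_sq_pos hk θ)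
  refine intervalIntegral.intervalIntegral_pos_of_pos (Continuous.intervalIntegrable
    (Continuous.div (by fun_prop) (by fun_prop) fun θ => (h θ).ne') _ _) (fun θ => ?_)
    (by have := Real.pi_pos; positivity)
  have := h θ
  positivity

lemma Kell_eq_integral_cos :
    Kell k = ∫ θ in (0 : ℝ)..(π / 2), 1 / √(1 - k ^ 2 * Real.cos θ ^ 2) := by
  have := intervalIntegral.integral_comp_sub_left (a := 0) (b := π / 2)
    (fun θ => 1 / √(1 - k ^ 2 * Real.sin θ ^ 2)) (π / 2)
  simp only [Real.sin_pi_div_two_sub, sub_self, sub_zero] at this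
  rw [this, Kell_eq_integral_sin hk]

/-- Landen's transformation of the complete elliptic integral. -/
lemma Kell_landen : Kell (2 * √k / (1 + k)) = (1 + k) * Kell k := by
  obtain ⟨h0, h1⟩ := hk
  rw [Kell, Kell, intervalIntegral.integral_of_le zero_le_one,
    intervalIntegral.integral_of_le zero_le_one,
    MeasureTheory.integral_Ioc_eq_integral_Ioo, MeasureTheory.integral_Ioc_eq_integral_Ioo]
  set g : ℝ → ℝ := fun y => (1 + k) * y / (1 + k * y ^ 2) with hg
  have hpos : ∀ y : ℝ, 0 < 1 + k * y ^ 2 := fun y => by positivity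
  have hkey : ∀ y ∈ Ioo (0 : ℝ) 1, 0 < 1 - k * y ^ 2 := fun y hy => by
    nlinarith [hy.1, hy.2, mul_pos hy.1 h0]
  have hder : ∀ y : ℝ, HasDerivAt g ((1 + k) * (1 - k * y ^ 2) / (1 + k * y ^ 2) ^ 2) y := by
    intro y
    have h1 : HasDerivAt (fun y : ℝ => (1 + k) * y) (1 + k) y := by
      simpa using (hasDerivAt_id y).const_mul (1 + k)
    have h2 : HasDerivAt (fun y : ℝ => 1 + k * y ^ 2) (k * (2 * y)) y := by
      simpa using ((hasDerivAt_pow 2 y).const_mul k).const_add 1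
    have h := h1.div h2 (hpos y).ne'
    have e : (1 + k) * (1 - k * y ^ 2) = (1 + k) * (1 + k * y ^ 2) - (1 + k) * y * (k * (2 * y)) := by
      ring
    rw [e]
    exact h
  have hmono : StrictMonoOn g (Icc 0 1) := by
    refine strictMonoOn_of_deriv_pos (convex_Icc 0 1)
      (fun y _ => (hder y).continuousAt.continuousWithinAt) fun y hy => ?_
    rw [interior_Icc] at hy
    rw [(hder y).deriv]
    have := hkey y hy
    have := hpos y
    positivity
  have himg : g '' Ioo 0 1 = Ioo 0 1 := by
    have g0 : g 0 = 0 := by simp [hg]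
    have g1 : g 1 = 1 := by simp only [hg]; field_simp
    have hc : ContinuousOn g (Icc 0 1) := fun y _ => (hder y).continuousAt.continuousWithinAt
    refine Subset.antisymm ?_ ?_
    · rintro _ ⟨y, hy, rfl⟩
      have a := hmono (left_mem_Icc.2 zero_le_one) ⟨hy.1.le, hy.2.le⟩ hy.1
      have b := hmono ⟨hy.1.le, hy.2.le⟩ (right_mem_Icc.2 zero_le_one) hy.2
      rw [g0] at a
      rw [g1] at b
      exact ⟨a, b⟩
    · have := intermediate_value_Ioo zero_le_one hc
      rwa [g0, g1] at this
  rw [← MeasureTheory.integral_const_mul]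
  conv_lhs => rw [← himg]
  rw [MeasureTheory.integral_image_eq_integral_abs_deriv_smul measurableSet_Ioo
    (fun y _ => (hder y).hasDerivWithinAt) (hmono.injOn.mono Ioo_subset_Icc_self)]
  refine MeasureTheory.setIntegral_congr_fun measurableSet_Ioo fun y hy => ?_
  have e1 := hkey y hy
  have e2 := hpos y
  have e3 : 0 < (1 - y ^ 2) * (1 - k ^ 2 * y ^ 2) := by
    have : 0 < 1 - y ^ 2 := by nlinarith [hy.1, hy.2]
    have : 0 < 1 - k ^ 2 * y ^ 2 := by nlinarith [hy.1, hy.2, mul_pos h0 hy.1]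
    positivity
  have e4 : (1 - g y ^ 2) * (1 - (2 * √k / (1 + k)) ^ 2 * g y ^ 2) =
      ((1 - y ^ 2) * (1 - k ^ 2 * y ^ 2)) * ((1 - k * y ^ 2) / (1 + k * y ^ 2) ^ 2) ^ 2 := by
    have hk2 : (2 * √k / (1 + k)) ^ 2 = 4 * k / (1 + k) ^ 2 := by
      rw [div_pow, mul_pow, Real.sq_sqrt h0.le]
      norm_num
    rw [hk2]
    simp only [hg]
    field_simp
    ring
  have e5 := Real.sqrt_pos.2 e3
  simp only [smul_eq_mul]
  rw [e4, Real.sqrt_mul e3.le, Real.sqrt_sq (by positivity), abs_of_pos (by positivity)]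
  field_simp

end elliptic

/-- `(z d/dz)^j` applied to the power series with coefficients `a`. -/
def eulerSum (a : ℕ → ℝ) (j : ℕ) (z : ℂ) : ℂ := ∑' n : ℕ, ((n : ℂ) ^ j * a n) * z ^ n

section powerSeries

variable {a : ℕ → ℝ} {r C : ℝ} (hr : 0 < r) (ha : ∀ n, |a n| * r ^ n ≤ C)
include hr ha

lemma summable_pow_mul_abs_mul_pow (j : ℕ) {x : ℝ} (hx0 : 0 ≤ x) (hx : x < r) :
    Summable fun n : ℕ => (n : ℝ) ^ j * |a n| * x ^ n := by
  have hq : ‖x / r‖ < 1 := by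
    rw [Real.norm_of_nonneg (by positivity), div_lt_one hr]
    exact hx
  refine Summable.of_nonneg_of_le (fun n => by positivity) (fun n => ?_)
    ((summable_pow_mul_geometric_of_norm_lt_one j hq).mul_left C)
  have h1 : x ^ n = r ^ n * (x / r) ^ n := by
    rw [← mul_pow, mul_div_cancel₀ _ hr.ne']
  calc (n : ℝ) ^ j * |a n| * x ^ n = (|a n| * r ^ n) * ((n : ℝ) ^ j * (x / r) ^ n) := by
        rw [h1]; ring
    _ ≤ C * ((n : ℝ) ^ j * (x / r) ^ n) := by
        gcongr
        exact ha n

lemma hasSum_eulerSum (j : ℕ) {z : ℂ} (hz : ‖z‖ < r) :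
    HasSum (fun n : ℕ => ((n : ℂ) ^ j * a n) * z ^ n) (eulerSum a j z) := by
  refine Summable.hasSum (Summable.of_norm ?_)
  refine (summable_pow_mul_abs_mul_pow hr ha j (norm_nonneg z) hz).congr fun n => ?_
  simp

lemma hasDerivAt_eulerSum_tsum (j : ℕ) {z : ℂ} (hz : ‖z‖ < r) :
    HasDerivAt (eulerSum a j) (∑' n : ℕ, ((n : ℂ) ^ j * a n) * (n * z ^ (n - 1))) z := by
  obtain ⟨x, hzx, hxr⟩ := exists_between hz
  have hx0 : 0 < x := (norm_nonneg z).trans_lt hzx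
  have hu := (summable_pow_mul_abs_mul_pow hr ha (j + 1) hx0.le hxr).div_const x
  refine hasDerivAt_tsum_of_isPreconnected (t := Metric.ball (0 : ℂ) x) (y₀ := 0) (y := z)
    (g := fun (n : ℕ) (y : ℂ) => ((n : ℂ) ^ j * a n) * y ^ n)
    (g' := fun (n : ℕ) (y : ℂ) => ((n : ℂ) ^ j * a n) * (n * y ^ (n - 1)))
    hu Metric.isOpen_ball (convex_ball _ _).isPreconnected
    (fun n y _ => (hasDerivAt_pow n y).const_mul _) (fun n y hy => ?_)
    (Metric.mem_ball_self hx0)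
    (hasSum_eulerSum hr ha j (by simpa using hr)).summable
    (by simpa using hzx)
  cases n with
  | zero => simp
  | succ n =>
    have hy' : ‖y‖ ≤ x := by simpa using (Metric.mem_ball.1 hy).le
    have e : ((n + 1 : ℕ) : ℝ) ^ (j + 1) * |a (n + 1)| * x ^ (n + 1) / x =
        ((n + 1 : ℕ) : ℝ) ^ j * |a (n + 1)| * (((n + 1 : ℕ) : ℝ) * x ^ n) := by
      rw [div_eq_iff hx0.ne']
      ring
    rw [e]
    simp only [norm_mul, norm_pow, Complex.norm_natCast, Complex.norm_real, Real.norm_eq_abs,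
      Nat.add_sub_cancel]
    gcongr

lemma hasDerivAt_eulerSum (j : ℕ) {z : ℂ} (hz : ‖z‖ < r) (hz0 : z ≠ 0) :
    HasDerivAt (eulerSum a j) (eulerSum a (j + 1) z / z) z := by
  refine (hasDerivAt_eulerSum_tsum hr ha j hz).congr_deriv ?_
  rw [eulerSum, ← tsum_div_const]
  refine tsum_congr fun n => ?_
  cases n with
  | zero => simp
  | succ n =>
    rw [Nat.add_sub_cancel, eq_div_iff hz0]
    ring

end powerSeries

/-- A power series vanishing on an interval to the right of `0` has vanishing coefficients. -/
lemma coeff_eq_zero_of_hasSum_zero {δ : ℝ} (hδ : 0 < δ) (n : ℕ) : ∀ {e : ℕ → ℝ},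
    (∀ x ∈ Ioo 0 δ, HasSum (fun n => e n * x ^ n) 0) → e n = 0 := by
  have key : ∀ {e : ℕ → ℝ}, (∀ x ∈ Ioo 0 δ, HasSum (fun n => e n * x ^ n) 0) → e 0 = 0 := by
    intro e he
    have hx := he (δ / 2) ⟨by linarith, by linarith⟩
    obtain ⟨C, hC⟩ := hx.summable.tendsto_atTop_zero.abs.bddAbove_range
    have hx4 : 0 < δ / 2 := by linarith
    have hb : ∀ n, |e n| * (δ / 2) ^ n ≤ C := fun n => by
      have := hC ⟨n, rfl⟩
      simpa only [abs_mul, abs_pow, abs_of_pos hx4] using this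
    have hpre : ∀ x ∈ Ioo 0 (δ / 4), e 0 = -(x * ∑' n, e (n + 1) * x ^ n) := by
      intro x hx
      have h := (he x ⟨hx.1, by linarith [hx.2]⟩)
      have h' := h.summable.tsum_eq_zero_add
      rw [h.tsum_eq, ← tsum_mul_left] at *
      have : ∀ n, e (n + 1) * x ^ (n + 1) = x * (e (n + 1) * x ^ n) := fun n => by ring
      simp only [this] at h'
      simp at h'
      linarith
    have hbd : ∃ M, ∀ x ∈ Ioo 0 (δ / 4), |∑' n, e (n + 1) * x ^ n| ≤ M := by
      have hs := (summable_nat_add_iff 1).2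
        (summable_pow_mul_abs_mul_pow hx4 hb 0 (x := δ / 4) (by positivity) (by linarith))
      refine ⟨(∑' n : ℕ, ((n + 1 : ℕ) : ℝ) ^ 0 * |e (n + 1)| * (δ / 4) ^ (n + 1)) / (δ / 4),
        fun x hx => ?_⟩
      rw [← tsum_div_const, ← Real.norm_eq_abs]
      refine tsum_of_norm_bounded (hs.div_const _).hasSum fun n => ?_
      have h1 := hx.1
      have : ((n + 1 : ℕ) : ℝ) ^ 0 * |e (n + 1)| * (δ / 4) ^ (n + 1) / (δ / 4) =
        |e (n + 1)| * (δ / 4) ^ n := by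
        rw [div_eq_iff (by positivity)]
        ring
      rw [this, norm_mul, norm_pow, Real.norm_eq_abs, Real.norm_eq_abs, abs_of_pos h1]
      gcongr
      exact hx.2.le
    obtain ⟨M, hM⟩ := hbd
    by_contra h0
    have h0' : 0 < |e 0| := abs_pos.2 h0
    have hMp : 0 < |M| + 1 := by positivity
    obtain ⟨x, hx0, hx1⟩ := exists_between (lt_min (show 0 < δ / 4 by linarith)
      (show 0 < |e 0| / (|M| + 1) by positivity))
    have hx : x ∈ Ioo 0 (δ / 4) := ⟨hx0, hx1.trans_le (min_le_left _ _)⟩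
    have h1 := hpre x hx
    have h2 := hM x hx
    have h3 : x * (|M| + 1) < |e 0| := (lt_div_iff₀ hMp).1 (hx1.trans_le (min_le_right _ _))
    rw [h1, abs_neg, abs_mul, abs_of_pos hx0] at h3
    nlinarith [le_abs_self M]
  induction n with
  | zero => exact key
  | succ n ih =>
    intro e he
    refine ih (e := fun n => e (n + 1)) fun x hx => ?_
    have h0 := key he
    have h := (hasSum_nat_add_iff' 1).2 (he x hx)
    simp only [Finset.sum_range_one, h0] at h
    have h' := h.mul_left x⁻¹
    have hx0 := hx.1.ne'
    have e1 : ∀ n, x⁻¹ * (e (n + 1) * x ^ (n + 1)) = e (n + 1) * x ^ n := fun n => by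
      rw [pow_succ]
      field_simp
    simpa only [e1, zero_mul, sub_zero, mul_zero] using h'

lemma HasSum.congr_term {M : Type*} [AddCommMonoid M] [TopologicalSpace M] {f g : ℕ → M} {S : M}
    (hf : HasSum f S) (h : ∀ n, f n = g n) : HasSum g S := by
  rwa [← funext h]

/-- The coefficients of `z² Σ bₙ zⁿ`. -/
def shiftTwo (b : ℕ → ℝ) : ℕ → ℝ
  | 0 => 0
  | 1 => 0
  | n + 2 => b n

lemma hasSum_shiftTwo {b : ℕ → ℝ} {z S : ℂ} (h : HasSum (fun n => (b n : ℂ) * z ^ n) S) :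
    HasSum (fun n => (shiftTwo b n : ℂ) * z ^ n) (z ^ 2 * S) := by
  refine (hasSum_nat_add_iff' 2).1 ?_
  have hmul := h.mul_left (z ^ 2)
  have e : ∀ n, z ^ 2 * ((b n : ℂ) * z ^ n) = (b n : ℂ) * z ^ (n + 2) := fun n => by ring
  simpa [Finset.sum_range_succ, shiftTwo, e] using hmul

/-- The differential operator annihilating `f_m` (with `κ = s²`), in terms of Euler derivatives. -/
def eulerODE (a : ℕ → ℝ) (s μ c : ℝ) (z : ℂ) : ℂ :=
  s ^ 2 * (eulerSum a 2 z - eulerSum a 1 z) -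
    z ^ 2 * ((1 + s ^ 4) * eulerSum a 2 z - μ ^ 2 * eulerSum a 0 z) +
    z ^ 2 * (z ^ 2 * (s ^ 2 * (eulerSum a 2 z + eulerSum a 1 z))) + z ^ 2 * (μ ^ 2 * c)

/-- The Taylor coefficients of `eulerODE`. -/
def eulerODECoeff (a : ℕ → ℝ) (s μ c : ℝ) (n : ℕ) : ℝ :=
  s ^ 2 * ((n : ℝ) ^ 2 * a n - n * a n) -
    shiftTwo (fun n => (1 + s ^ 4) * ((n : ℝ) ^ 2 * a n) - μ ^ 2 * a n) n +
    shiftTwo (shiftTwo fun n => s ^ 2 * ((n : ℝ) ^ 2 * a n + n * a n)) n +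
    shiftTwo (fun n => if n = 0 then μ ^ 2 * c else 0) n

lemma hasSum_eulerODE {a : ℕ → ℝ} {r C : ℝ} (hr : 0 < r) (ha : ∀ n, |a n| * r ^ n ≤ C)
    (s μ c : ℝ) {z : ℂ} (hz : ‖z‖ < r) :
    HasSum (fun n => (eulerODECoeff a s μ c n : ℂ) * z ^ n) (eulerODE a s μ c z) := by
  have h0 := hasSum_eulerSum hr ha 0 hz
  have h1 := hasSum_eulerSum hr ha 1 hz
  have h2 := hasSum_eulerSum hr ha 2 hz
  have hA := (h2.sub h1).mul_left ((s : ℂ) ^ 2)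
  have hB := hasSum_shiftTwo (b := fun n => (1 + s ^ 4) * ((n : ℝ) ^ 2 * a n) - μ ^ 2 * a n)
    (z := z) (by
      refine ((h2.mul_left (1 + (s : ℂ) ^ 4)).sub (h0.mul_left ((μ : ℂ) ^ 2))).congr_term
        fun n => ?_
      push_cast
      ring)
  have hD := hasSum_shiftTwo (z := z) (hasSum_shiftTwo (z := z)
    (b := fun n => s ^ 2 * ((n : ℝ) ^ 2 * a n + n * a n)) (by
      refine ((h2.add h1).mul_left ((s : ℂ) ^ 2)).congr_term fun n => ?_
      push_cast
      ring))
  have hE := hasSum_shiftTwo (b := fun n => if n = 0 then μ ^ 2 * c else 0) (z := z)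
    (S := μ ^ 2 * c) (by
      refine (hasSum_ite_eq 0 ((μ : ℂ) ^ 2 * c)).congr_term fun n => ?_
      split_ifs with h
      · simp [h]
      · simp)
  refine (((hA.sub hB).add hD).add hE).congr_term fun n => ?_
  rw [eulerODECoeff]
  push_cast
  ring

lemma eulerODECoeff_eq_zero {a : ℕ → ℝ} {r C : ℝ} (hr : 0 < r) (ha : ∀ n, |a n| * r ^ n ≤ C)
    {s μ c : ℝ} {δ : ℝ} (hδ : 0 < δ) (h : ∀ x ∈ Ioo 0 δ, eulerODE a s μ c (x : ℝ) = 0) (n : ℕ) :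
    eulerODECoeff a s μ c n = 0 := by
  refine coeff_eq_zero_of_hasSum_zero (lt_min hδ hr) n fun x hx => ?_
  have hz : ‖(x : ℂ)‖ < r := by
    rw [Complex.norm_real, Real.norm_of_nonneg hx.1.le]
    exact hx.2.trans_le (min_le_right _ _)
  have hs := hasSum_eulerODE hr ha s μ c hz
  rw [h x ⟨hx.1, hx.2.trans_le (min_le_left _ _)⟩] at hs
  rw [← Complex.hasSum_ofReal]
  push_cast
  exact hs

/-- A sequence of exponential growth rate at most `1` satisfying a dichotomy-type three term
inequality decays exponentially. -/
lemma exists_decay {a : ℕ → ℝ} {A : ℝ} (hA : 2 < A) {J : ℕ}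
    (h : ∀ n ≥ J, A * |a (n + 2)| ≤ |a (n + 4)| + |a n|)
    (hb : ∀ r ∈ Ioo (0 : ℝ) 1, ∃ C, ∀ n, |a n| * r ^ n ≤ C) :
    ∃ R > 1, ∃ C, ∀ n, |a n| * R ^ n ≤ C := by
  have hgrow : ∀ n ≥ J, |a n| ≤ |a (n + 2)| → a (n + 2) = 0 := by
    intro n hn h0
    have hj : ∀ j, |a (n + 2 * j)| ≤ |a (n + 2 * j + 2)| ∧
        (A - 1) ^ j * |a (n + 2)| ≤ |a (n + 2 * j + 2)| := by
      intro j
      induction j with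
      | zero => exact ⟨h0, by simp⟩
      | succ j ih =>
        have h1 := h (n + 2 * j) (by omega)
        have e : n + 2 * (j + 1) = n + 2 * j + 2 := by ring
        have h2 : (A - 1) * |a (n + 2 * j + 2)| ≤ |a (n + 2 * j + 2 + 2)| := by
          linarith [ih.1]
        rw [e]
        refine ⟨by nlinarith [abs_nonneg (a (n + 2 * j + 2))], ?_⟩
        calc (A - 1) ^ (j + 1) * |a (n + 2)| = (A - 1) * ((A - 1) ^ j * |a (n + 2)|) := by ring
          _ ≤ (A - 1) * |a (n + 2 * j + 2)| :=
            mul_le_mul_of_nonneg_left ih.2 (by linarith)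
          _ ≤ _ := h2
    by_contra hne
    have hpos : 0 < |a (n + 2)| := abs_pos.2 hne
    obtain ⟨y, hy0, hy1⟩ := exists_between (show 1 / (A - 1) < 1 by
      rw [div_lt_one (by linarith)]; linarith)
    have hyp : 0 < y := lt_trans (by have : 0 < A - 1 := by linarith
                                     positivity) hy0
    have hr : √y ∈ Ioo (0 : ℝ) 1 :=
      ⟨Real.sqrt_pos.2 hyp, by rw [Real.sqrt_lt' one_pos]; simpa using hy1⟩
    obtain ⟨C, hC⟩ := hb _ hr
    have hg : 1 < (A - 1) * y := by
      rw [div_lt_iff₀ (by linarith)] at hy0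
      linarith
    obtain ⟨j, hj'⟩ := pow_unbounded_of_one_lt (C / (|a (n + 2)| * √y ^ (n + 2))) hg
    have hden : 0 < |a (n + 2)| * √y ^ (n + 2) := mul_pos hpos (pow_pos hr.1 _)
    rw [div_lt_iff₀ hden] at hj'
    have h3 := hC (n + 2 * j + 2)
    have h4 : √y ^ (n + 2 * j + 2) = y ^ j * √y ^ (n + 2) := by
      rw [show n + 2 * j + 2 = 2 * j + (n + 2) by ring, pow_add, pow_mul, Real.sq_sqrt hyp.le]
    have h5 := mul_le_mul_of_nonneg_right (hj j).2 (pow_nonneg hr.1.le (n + 2 * j + 2))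
    rw [h4] at h3 h5
    have : ((A - 1) * y) ^ j * (|a (n + 2)| * √y ^ (n + 2)) =
      (A - 1) ^ j * |a (n + 2)| * (y ^ j * √y ^ (n + 2)) := by rw [mul_pow]; ring
    linarith
  have hmono : ∀ n ≥ J, |a (n + 2)| ≤ |a n| := by
    intro n hn
    by_contra! hlt
    rw [hgrow n hn hlt.le, abs_zero] at hlt
    exact absurd hlt (not_lt.2 (abs_nonneg _))
  have hR : 1 < √(A - 1) := by
    rw [Real.lt_sqrt zero_le_one]
    linarith
  have hdec : ∀ n ≥ J, |a (n + 2)| * √(A - 1) ^ (n + 2) ≤ |a n| * √(A - 1) ^ n := by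
    intro n hn
    have h1 := h n hn
    have h2 := hmono (n + 2) (by omega)
    rw [pow_add, Real.sq_sqrt (by linarith)]
    have : |a (n + 2)| * (A - 1) ≤ |a n| := by linarith
    nlinarith [pow_pos (zero_lt_one.trans hR) n]
  refine ⟨_, hR, ∑ i ∈ Finset.range (J + 2), |a i| * √(A - 1) ^ i, fun n => ?_⟩
  induction n using Nat.strong_induction_on with
  | _ n ih =>
    by_cases hn : n < J + 2
    · exact Finset.single_le_sum (f := fun i => |a i| * √(A - 1) ^ i)
        (fun i _ => by positivity) (Finset.mem_range.2 hn)
    · obtain ⟨p, rfl⟩ : ∃ p, n = p + 2 := ⟨n - 2, by omega⟩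
      exact (hdec p (by omega)).trans (ih p (by omega))

lemma exists_decay_of_eulerODECoeff {a : ℕ → ℝ} {s μ c : ℝ} (hs : s ∈ Ioo (0 : ℝ) 1)
    (h : ∀ n, eulerODECoeff a s μ c n = 0)
    (hb : ∀ r ∈ Ioo (0 : ℝ) 1, ∃ C, ∀ n, |a n| * r ^ n ≤ C) :
    ∃ R > 1, ∃ C, ∀ n, |a n| * R ^ n ≤ C := by
  obtain ⟨h0, h1⟩ := hs
  have hs2 : 0 < 1 - s ^ 2 := by nlinarith
  have hs0 : 0 < s ^ 2 := by positivity
  obtain ⟨J, hJ⟩ := exists_nat_ge ((38 + μ ^ 2) / ((1 - s ^ 2) ^ 2 / 2))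
  rw [div_le_iff₀ (by positivity)] at hJ
  refine exists_decay (A := (1 + s ^ 2) ^ 2 / 2 / s ^ 2) (J := J + 1) ?_ (fun n hn => ?_) hb
  · rw [lt_div_iff₀ hs0]
    nlinarith
  · have hrec := h (n + 4)
    simp only [eulerODECoeff, shiftTwo] at hrec
    push_cast at hrec
    have hn1 : (1 : ℝ) ≤ n := by exact_mod_cast (by omega : 1 ≤ n)
    have hnJ : (J : ℝ) ≤ n := by exact_mod_cast (by omega : J ≤ n)
    have hcoef : (1 + s ^ 2) ^ 2 / 2 * ((n + 4) * (n + 3)) ≤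
        (1 + s ^ 4) * ((n : ℝ) + 2) ^ 2 - μ ^ 2 := by
      have e1 : 38 + μ ^ 2 ≤ n * ((1 - s ^ 2) ^ 2 / 2) :=
        hJ.trans (mul_le_mul_of_nonneg_right hnJ (by positivity))
      have e2 : n * (38 + μ ^ 2) ≤ n * (n * ((1 - s ^ 2) ^ 2 / 2)) :=
        mul_le_mul_of_nonneg_left e1 (by linarith)
      have e3 : (1 + s ^ 2) ^ 2 / 2 ≤ 2 := by nlinarith
      have e4 : (1 + s ^ 2) ^ 2 / 2 * (7 * n + 12) ≤ 2 * (7 * n + 12) :=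
        mul_le_mul_of_nonneg_right e3 (by linarith)
      have e5 : μ ^ 2 ≤ n * μ ^ 2 := le_mul_of_one_le_left (sq_nonneg _) hn1
      have e6 : 0 ≤ (1 + s ^ 4) * (4 * n + 4) := by positivity
      nlinarith
    set x := |a (n + 2)|
    set y := |a (n + 4)|
    set w := |a n|
    have hw : 0 ≤ w := abs_nonneg _
    have hx : 0 ≤ x := abs_nonneg _
    have key : ((1 + s ^ 4) * ((n : ℝ) + 2) ^ 2 - μ ^ 2) * x ≤
        s ^ 2 * ((n + 4) * (n + 3)) * y + s ^ 2 * (n * (n + 1)) * w := by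
      have e : ((1 + s ^ 4) * ((n : ℝ) + 2) ^ 2 - μ ^ 2) * a (n + 2) =
          s ^ 2 * ((n + 4) * (n + 3)) * a (n + 4) + s ^ 2 * (n * (n + 1)) * a n := by
        simp at hrec
        linarith
      have p1 : 0 ≤ (1 + s ^ 4) * ((n : ℝ) + 2) ^ 2 - μ ^ 2 := le_trans (by positivity) hcoef
      calc _ = |((1 + s ^ 4) * ((n : ℝ) + 2) ^ 2 - μ ^ 2) * a (n + 2)| := by
            rw [abs_mul, abs_of_nonneg p1]
        _ ≤ _ := by
            rw [e]
            refine (abs_add_le _ _).trans (le_of_eq ?_)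
            rw [abs_mul _ (a (n + 4)), abs_mul _ (a n),
              abs_of_nonneg (show 0 ≤ s ^ 2 * (((n : ℝ) + 4) * (n + 3)) by positivity),
              abs_of_nonneg (show 0 ≤ s ^ 2 * ((n : ℝ) * (n + 1)) by positivity)]
    have k1 : (1 + s ^ 2) ^ 2 / 2 * ((n + 4) * (n + 3)) * x ≤
        s ^ 2 * ((n + 4) * (n + 3)) * (y + w) := by
      have e1 := mul_le_mul_of_nonneg_right hcoef hx
      have e2 : s ^ 2 * ((n : ℝ) * (n + 1)) * w ≤ s ^ 2 * ((n + 4) * (n + 3)) * w := by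
        gcongr <;> linarith
      linarith
    have hq : (0 : ℝ) < (n + 4) * (n + 3) := by positivity
    have k2 : (1 + s ^ 2) ^ 2 / 2 * x ≤ s ^ 2 * (y + w) := by
      refine le_of_mul_le_mul_left ?_ hq
      linarith
    rw [div_mul_eq_mul_div, div_le_iff₀ hs0]
    linarith

section coefficients

variable {s : ℝ} (hs : s ∈ Ioo (0 : ℝ) 1) {v : ℂ → ℂ} (hv : IsVmap (s ^ 2) v)
  {a : ℕ → ℕ → ℝ} (ha : IsCoeff (s ^ 2) v a) {m : ℕ} (hm : 1 ≤ m)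

include ha hm in
lemma IsCoeff.exists_bound {r : ℝ} (hr : r ∈ Ioo (0 : ℝ) 1) : ∃ C, ∀ n, |a n m| * r ^ n ≤ C := by
  obtain ⟨h0, h1⟩ := hr
  have h := ha m hm (r * Complex.I) (by simp [slitDom, h0.ne']) (by simpa [abs_of_pos h0] using h1)
  obtain ⟨C, hC⟩ := h.summable.tendsto_atTop_zero.norm.bddAbove_range
  refine ⟨C, fun n => ?_⟩
  have := hC ⟨n, rfl⟩
  simpa [abs_of_pos h0] using this

include ha hm in
lemma IsCoeff.eulerSum_zero {z : ℂ} (hz : z ∈ slitDom (s ^ 2)) (hz1 : ‖z‖ < 1) :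
    eulerSum (fun n => a n m) 0 z = fmFun v m z := by
  rw [← (ha m hm z hz hz1).tsum_eq, eulerSum]
  simp

lemma mem_slitDom_ofReal {x : ℝ} (hx : x ^ 2 < s ^ 2) : (x : ℂ) ∈ slitDom (s ^ 2) := by
  simp [slitDom, hx]

include hs in
lemma quartic_pos {x : ℝ} (hx : x ^ 2 < s ^ 2) : 0 < (s ^ 2 - x ^ 2) * (1 - s ^ 2 * x ^ 2) := by
  have h1 : s ^ 2 < 1 := by nlinarith [hs.1, hs.2]
  have h2 : 0 < 1 - s ^ 2 * x ^ 2 := by nlinarith [sq_nonneg x, sq_nonneg s]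
  exact mul_pos (by linarith) h2

include hs hv in
lemma hasDerivAt_cos_v (m : ℕ) {x : ℝ} (hx : x ^ 2 < s ^ 2) :
    HasDerivAt (fun z => 2 * (π : ℂ) * m * (v z + 1 / 4))
      ((2 * π * m / (4 * Kell (s ^ 2)) / √((s ^ 2 - x ^ 2) * (1 - s ^ 2 * x ^ 2)) : ℝ) : ℂ) x := by
  have h := ((hv.deriv_real x hx).add_const (1 / 4)).const_mul (2 * (π : ℂ) * m)
  refine h.congr_deriv ?_
  push_cast
  have h1 : ((√((s ^ 2 - x ^ 2) * (1 - s ^ 2 * x ^ 2)) : ℝ) : ℂ) ≠ 0 := by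
    exact_mod_cast (Real.sqrt_pos.2 (quartic_pos hs hx)).ne'
  ring

include hs hv ha hm in
lemma IsCoeff.eulerSum_one_mul {x : ℝ} (hx0 : 0 < x) (hxs : x < s) :
    eulerSum (fun n => a n m) 1 x * (√((s ^ 2 - x ^ 2) * (1 - s ^ 2 * x ^ 2)) : ℝ) =
      -((2 * π * m / (4 * Kell (s ^ 2)) : ℝ) * x *
        Complex.sin (2 * (π : ℂ) * m * (v x + 1 / 4))) := by
  have hx : x ^ 2 < s ^ 2 := by nlinarith
  obtain ⟨r, hr0, hr1⟩ := exists_between (hxs.trans hs.2)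
  obtain ⟨C, hC⟩ := ha.exists_bound hm ⟨hx0.trans hr0, hr1⟩
  have hxc : (x : ℂ) ≠ 0 := by exact_mod_cast hx0.ne'
  have h1 := hasDerivAt_eulerSum (hx0.trans hr0) hC 0 (z := x) (by simpa [abs_of_pos hx0]) hxc
  have h2 : HasDerivAt (fmFun v m) _ (x : ℂ) :=
    ((hasDerivAt_cos_v hs hv m hx).ccos).sub_const (Complex.cos ((π : ℂ) * m / 2))
  have hev : eulerSum (fun n => a n m) 0 =ᶠ[nhds (x : ℂ)] fmFun v m := by
    have hop : IsOpen {z : ℂ | z.re ^ 2 < s ^ 2 ∧ ‖z‖ < 1} := by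
      refine IsOpen.and ?_ ?_
      · exact isOpen_lt (by fun_prop) (by fun_prop)
      · exact isOpen_lt (by fun_prop) (by fun_prop)
    filter_upwards [hop.mem_nhds (x := (x : ℂ)) ⟨by simpa using hx, by
      simpa [abs_of_pos hx0] using hxs.trans hs.2⟩] with z hz
    exact ha.eulerSum_zero hm (fun h => absurd h.2 (not_le.2 hz.1)) hz.2
  have h3 := h1.unique (h2.congr_of_eventuallyEq hev)
  have hP : ((√((s ^ 2 - x ^ 2) * (1 - s ^ 2 * x ^ 2)) : ℝ) : ℂ) ≠ 0 := by
    exact_mod_cast (Real.sqrt_pos.2 (quartic_pos hs hx)).ne'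
  rw [div_eq_iff hxc] at h3
  rw [h3, Complex.ofReal_div]
  field_simp

include hs hv ha hm in
lemma IsCoeff.eulerODE_eq_zero_of_lt {x : ℝ} (hx0 : 0 < x) (hxs : x < s) :
    eulerODE (fun n => a n m) s (2 * π * m / (4 * Kell (s ^ 2))) (Real.cos (π * m / 2)) x = 0 := by
  have hx : x ^ 2 < s ^ 2 := by nlinarith
  obtain ⟨r, hr0, hr1⟩ := exists_between (hxs.trans hs.2)
  obtain ⟨C, hC⟩ := ha.exists_bound hm ⟨hx0.trans hr0, hr1⟩
  have hxc : (x : ℂ) ≠ 0 := by exact_mod_cast hx0.ne'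
  have hP := Real.sqrt_pos.2 (quartic_pos hs hx)
  have h1 := (hasDerivAt_eulerSum (hx0.trans hr0) hC 1 (z := x) (by simpa [abs_of_pos hx0])
    hxc).comp_ofReal
  have hP' : HasDerivAt (fun x : ℝ => (s ^ 2 - x ^ 2) * (1 - s ^ 2 * x ^ 2))
      (-(2 * x) * (1 - s ^ 2 * x ^ 2) + (s ^ 2 - x ^ 2) * (-(s ^ 2 * (2 * x)))) x := by
    have e1 : HasDerivAt (fun x : ℝ => s ^ 2 - x ^ 2) (-(2 * x)) x := by
      simpa using (hasDerivAt_pow 2 x).const_sub (s ^ 2)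
    have e2 : HasDerivAt (fun x : ℝ => 1 - s ^ 2 * x ^ 2) (-(s ^ 2 * (2 * x))) x := by
      simpa using ((hasDerivAt_pow 2 x).const_mul (s ^ 2)).const_sub 1
    exact e1.mul e2
  have h2 := (hP'.sqrt (quartic_pos hs hx).ne').ofReal_comp
  have h3 := ((hasDerivAt_cos_v hs hv m hx).csin).comp_ofReal
  have h4 := ((hasDerivAt_id x).ofReal_comp).const_mul
    ((2 * π * m / (4 * Kell (s ^ 2)) : ℝ) : ℂ)
  have hG := (h1.mul h2).add (h4.mul h3)
  have hD := (hG.congr_of_eventuallyEq (f₁ := fun _ => (0 : ℂ)) (by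
    filter_upwards [isOpen_Ioo.mem_nhds (show x ∈ Ioo 0 s from ⟨hx0, hxs⟩)] with y hy
    exact (add_eq_zero_iff_eq_neg.2 (ha.eulerSum_one_mul hs hv hm hy.1 hy.2)).symm)).unique
      (hasDerivAt_const x (0 : ℂ))
  have hloc := ha.eulerSum_one_mul hs hv hm hx0 hxs
  have hf0 := ha.eulerSum_zero hm (mem_slitDom_ofReal hx)
    (by simpa [abs_of_pos hx0] using hxs.trans hs.2)
  have hR2 : ((√((s ^ 2 - x ^ 2) * (1 - s ^ 2 * x ^ 2)) : ℝ) : ℂ) ^ 2 =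
      (s ^ 2 - x ^ 2) * (1 - s ^ 2 * x ^ 2) := by
    rw [← Complex.ofReal_pow, Real.sq_sqrt (quartic_pos hs hx).le]
    push_cast
    rfl
  have hR0 : ((√((s ^ 2 - x ^ 2) * (1 - s ^ 2 * x ^ 2)) : ℝ) : ℂ) ≠ 0 := by
    exact_mod_cast hP.ne'
  rw [fmFun] at hf0
  simp only [Complex.ofReal_div _ (√((s ^ 2 - x ^ 2) * (1 - s ^ 2 * x ^ 2))),
    Complex.ofReal_div _ (2 * √((s ^ 2 - x ^ 2) * (1 - s ^ 2 * x ^ 2))),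
    Complex.ofReal_mul 2 (√((s ^ 2 - x ^ 2) * (1 - s ^ 2 * x ^ 2)))] at hD
  simp only [id, Complex.ofReal_one, Complex.ofReal_ofNat] at hD
  rw [eulerODE]
  set R := ((√((s ^ 2 - x ^ 2) * (1 - s ^ 2 * x ^ 2)) : ℝ) : ℂ)
  set μ := ((2 * π * m / (4 * Kell (s ^ 2)) : ℝ) : ℂ)
  have hc : ((Real.cos (π * m / 2) : ℝ) : ℂ) = Complex.cos ((π : ℂ) * m / 2) := by
    push_cast
    rfl
  rw [hc]
  set W := 2 * (π : ℂ) * m * (v x + 1 / 4)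
  push_cast at hD
  norm_num at hD
  field_simp at hD
  linear_combination hD - R * hloc - (eulerSum (fun n => a n m) 2 x -
    eulerSum (fun n => a n m) 1 x) * hR2 + x ^ 2 * μ ^ 2 * hf0

include hs hv ha hm in
lemma IsCoeff.exists_decay : ∃ R > 1, ∃ C, ∀ n, |a n m| * R ^ n ≤ C := by
  obtain ⟨C, hC⟩ := ha.exists_bound hm (r := 1 / 2) ⟨by norm_num, by norm_num⟩
  refine exists_decay_of_eulerODECoeff hs (eulerODECoeff_eq_zero (by norm_num) hC hs.1 fun x hx =>
    ha.eulerODE_eq_zero_of_lt hs hv hm hx.1 hx.2) fun r hr => ha.exists_bound hm hr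

end coefficients

lemma eq_of_hasDerivAt_zero {b : ℝ} {f : ℝ → ℝ} (h : ∀ x ∈ Icc 0 b, HasDerivAt f 0 x) {x : ℝ}
    (hx : x ∈ Icc 0 b) : f x = f 0 :=
  constant_of_has_deriv_right_zero (fun y hy => (h y hy).continuousAt.continuousWithinAt)
    (fun y hy => (h y ⟨hy.1, hy.2.le⟩).hasDerivWithinAt) x hx

section phase

variable {b μ : ℝ} {y p r β : ℝ → ℝ} (hμ : μ ≠ 0) (hβ0 : β 0 = 0) (hp0 : p 0 = 0)
  (hr : ∀ x ∈ Icc 0 b, r x ≠ 0) (hβ : ∀ x ∈ Icc 0 b, HasDerivAt β (μ / r x) x)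
  (hy : ∀ x ∈ Icc 0 b, HasDerivAt y (p x / r x) x)
include hμ hβ0 hp0 hr hβ hy

/-- Solution of `(r d/dx)² y = -μ² y` with `y'(0) = 0`. -/
lemma eq_cos_of_hasDerivAt (hp : ∀ x ∈ Icc 0 b, HasDerivAt p (-(μ ^ 2 * y x) / r x) x)
    {x : ℝ} (hx : x ∈ Icc 0 b) :
    y x = y 0 * Real.cos (β x) ∧ p x = -(μ * y 0 * Real.sin (β x)) := by
  have h1 := eq_of_hasDerivAt_zero (b := b)
    (f := fun x => μ * (y x * Real.cos (β x)) - p x * Real.sin (β x)) (fun x hx => by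
      refine ((((hy x hx).mul (hβ x hx).cos).const_mul μ).sub
        ((hp x hx).mul (hβ x hx).sin)).congr_deriv ?_
      field_simp [hr x hx]
      ring) hx
  have h2 := eq_of_hasDerivAt_zero (b := b)
    (f := fun x => μ * (y x * Real.sin (β x)) + p x * Real.cos (β x)) (fun x hx => by
      refine ((((hy x hx).mul (hβ x hx).sin).const_mul μ).add
        ((hp x hx).mul (hβ x hx).cos)).congr_deriv ?_
      field_simp [hr x hx]
      ring) hx
  simp only [hβ0, hp0, Real.cos_zero, Real.sin_zero, mul_one, mul_zero, sub_zero,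
    add_zero] at h1 h2
  have h3 := Real.sin_sq_add_cos_sq (β x)
  refine ⟨mul_left_cancel₀ hμ ?_, ?_⟩
  · linear_combination Real.cos (β x) * h1 + Real.sin (β x) * h2 - μ * y x * h3
  · linear_combination Real.cos (β x) * h2 - Real.sin (β x) * h1 - p x * h3

/-- Solution of `(r d/dx)² y = μ² y` with `y'(0) = 0`. -/
lemma eq_cosh_of_hasDerivAt (hp : ∀ x ∈ Icc 0 b, HasDerivAt p (μ ^ 2 * y x / r x) x)
    {x : ℝ} (hx : x ∈ Icc 0 b) :
    y x = y 0 * Real.cosh (β x) ∧ p x = μ * y 0 * Real.sinh (β x) := by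
  have h1 := eq_of_hasDerivAt_zero (b := b)
    (f := fun x => μ * (y x * Real.cosh (β x)) - p x * Real.sinh (β x)) (fun x hx => by
      refine ((((hy x hx).mul (hβ x hx).cosh).const_mul μ).sub
        ((hp x hx).mul (hβ x hx).sinh)).congr_deriv ?_
      field_simp [hr x hx]
      ring) hx
  have h2 := eq_of_hasDerivAt_zero (b := b)
    (f := fun x => p x * Real.cosh (β x) - μ * (y x * Real.sinh (β x))) (fun x hx => by
      refine (((hp x hx).mul (hβ x hx).cosh).sub
        (((hy x hx).mul (hβ x hx).sinh).const_mul μ)).congr_deriv ?_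
      field_simp [hr x hx]
      ring) hx
  simp only [hβ0, hp0, Real.cosh_zero, Real.sinh_zero, mul_one, mul_zero, sub_zero]
    at h1 h2
  have h3 := Real.cosh_sq (β x)
  refine ⟨mul_left_cancel₀ hμ ?_, ?_⟩
  · linear_combination Real.cosh (β x) * h1 + Real.sinh (β x) * h2 - μ * y x * h3
  · linear_combination Real.cosh (β x) * h2 + Real.sinh (β x) * h1 - p x * h3

end phase

lemma hasDerivAt_integral_of_continuous {f : ℝ → ℝ} (hf : Continuous f) (x : ℝ) :
    HasDerivAt (fun x => ∫ t in (0 : ℝ)..x, f t) (f x) x :=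
  intervalIntegral.integral_hasDerivAt_right (hf.intervalIntegrable _ _)
    (hf.stronglyMeasurableAtFilter _ _) hf.continuousAt

/-- The phase `∫₀^θ dt/√(1 - k² cos² t)`. -/
def cosPhase (k θ : ℝ) : ℝ := ∫ t in (0 : ℝ)..θ, 1 / √(1 - k ^ 2 * Real.cos t ^ 2)

/-- The phase `∫₀^ψ dt/√(1 - k² sin² t)`. -/
def sinPhase (k ψ : ℝ) : ℝ := ∫ t in (0 : ℝ)..ψ, 1 / √(1 - k ^ 2 * Real.sin t ^ 2)

lemma hasDerivAt_cosPhase {k : ℝ} (hk : k ∈ Ioo (0 : ℝ) 1) (θ : ℝ) :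
    HasDerivAt (cosPhase k) (1 / √(1 - k ^ 2 * Real.cos θ ^ 2)) θ :=
  hasDerivAt_integral_of_continuous (Continuous.div (by fun_prop) (by fun_prop)
    fun θ => (Real.sqrt_pos.2 (delta_pos hk θ)).ne') θ

lemma hasDerivAt_sinPhase {k : ℝ} (hk : k ∈ Ioo (0 : ℝ) 1) (ψ : ℝ) :
    HasDerivAt (sinPhase k) (1 / √(1 - k ^ 2 * Real.sin ψ ^ 2)) ψ :=
  hasDerivAt_integral_of_continuous (Continuous.div (by fun_prop) (by fun_prop)
    fun θ => (Real.sqrt_pos.2 (one_sub_sq_mul_sin_sq_pos hk θ)).ne') ψ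

lemma HasDerivAt.re_comp {f : ℝ → ℂ} {f' : ℂ} {x : ℝ} (h : HasDerivAt f f' x) :
    HasDerivAt (fun x => (f x).re) f'.re x :=
  Complex.reCLM.hasFDerivAt.comp_hasDerivAt x h

lemma HasDerivAt.im_comp {f : ℝ → ℂ} {f' : ℂ} {x : ℝ} (h : HasDerivAt f f' x) :
    HasDerivAt (fun x => (f x).im) f'.im x :=
  Complex.imCLM.hasFDerivAt.comp_hasDerivAt x h

lemma eulerSum_ofReal (a : ℕ → ℝ) (j : ℕ) (x : ℝ) :
    eulerSum a j x = ((∑' n : ℕ, (n : ℝ) ^ j * a n * x ^ n : ℝ) : ℂ) := by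
  rw [Complex.ofReal_tsum, eulerSum]
  push_cast
  rfl

lemma eulerSum_ofReal_im (a : ℕ → ℝ) (j : ℕ) (x : ℝ) : (eulerSum a j x).im = 0 := by
  rw [eulerSum_ofReal, Complex.ofReal_im]

section landen

variable {s k : ℝ} (hs : s ∈ Ioo (0 : ℝ) 1) (hk : k = 2 * s / (1 + s ^ 2))
include hs hk

lemma modulus_mem_Ioo : k ∈ Ioo (0 : ℝ) 1 := by
  obtain ⟨h0, h1⟩ := hs
  rw [hk]
  refine ⟨by positivity, ?_⟩
  rw [div_lt_one (by positivity)]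
  nlinarith

end landen

section solution

variable {a : ℕ → ℝ} {R C : ℝ} (hR : 1 < R) (ha : ∀ n, |a n| * R ^ n ≤ C)
  {s k μ c : ℝ} (hs : s ∈ Ioo (0 : ℝ) 1) (hk : k = 2 * s / (1 + s ^ 2)) (hμ : μ ≠ 0)
  (hode : ∀ z : ℂ, ‖z‖ < R → eulerODE a s μ c z = 0)
include hR ha

lemma hasDerivAt_eulerSum_circle (j : ℕ) (θ : ℝ) :
    HasDerivAt (fun θ : ℝ => eulerSum a j (Complex.exp (θ * I)))
      (I * eulerSum a (j + 1) (Complex.exp (θ * I))) θ := by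
  have h1 : HasDerivAt (fun z : ℂ => Complex.exp (z * I)) (Complex.exp (θ * I) * I) (θ : ℂ) := by
    simpa using ((hasDerivAt_id (θ : ℂ)).mul_const I).cexp
  have hn : ‖Complex.exp (θ * I)‖ < R := by rwa [Complex.norm_exp_ofReal_mul_I]
  have h2 := hasDerivAt_eulerSum (zero_lt_one.trans hR) ha j hn (Complex.exp_ne_zero _)
  refine (h2.comp (θ : ℂ) h1).comp_ofReal.congr_deriv ?_
  field_simp [Complex.exp_ne_zero]

omit ha in
include hk hode in
lemma circle_ode (θ : ℝ) :
    (1 - k ^ 2 * Real.cos θ ^ 2) * (eulerSum a 2 (Complex.exp (θ * I))).re +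
      k ^ 2 * (Real.sin θ * Real.cos θ) * (eulerSum a 1 (Complex.exp (θ * I))).im =
      (μ / (1 + s ^ 2)) ^ 2 * ((eulerSum a 0 (Complex.exp (θ * I))).re + c) := by
  have h := hode (Complex.exp (θ * I)) (by rwa [Complex.norm_exp_ofReal_mul_I])
  rw [eulerODE] at h
  set F0 := eulerSum a 0 (Complex.exp (θ * I))
  set F1 := eulerSum a 1 (Complex.exp (θ * I))
  set F2 := eulerSum a 2 (Complex.exp (θ * I))
  have e1 : Complex.exp (θ * I) = Real.cos θ + Real.sin θ * I := by
    rw [Complex.exp_mul_I]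
    push_cast
    rfl
  have e2 : ((Real.cos θ : ℝ) : ℂ) ^ 2 + (Real.sin θ : ℝ) ^ 2 = 1 := by
    exact_mod_cast Real.cos_sq_add_sin_sq θ
  have e3 : (((Real.cos θ : ℝ) : ℂ) + (Real.sin θ : ℝ) * I) *
      ((Real.cos θ : ℝ) - (Real.sin θ : ℝ) * I) = 1 := by
    linear_combination e2 - ((Real.sin θ : ℝ) : ℂ) ^ 2 * Complex.I_sq
  rw [e1] at h
  set x := Real.cos θ
  set y := Real.sin θ
  have h' : (s : ℂ) ^ 2 * ((x - y * I) ^ 2 * (F2 - F1)) -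
      ((1 + s ^ 4) * F2 - μ ^ 2 * F0) + (x + y * I) ^ 2 * (s ^ 2 * (F2 + F1)) + μ ^ 2 * c = 0 := by
    linear_combination ((x : ℂ) - y * I) ^ 2 * h +
      ((((1 : ℂ) + s ^ 4) * F2 - μ ^ 2 * F0) - (x + y * I) ^ 2 * (s ^ 2 * (F2 + F1)) - μ ^ 2 * c) *
      (((x : ℂ) + y * I) * (x - y * I) + 1) * e3
  have hre := congrArg Complex.re h'
  simp only [pow_two, Complex.add_re, Complex.sub_re, Complex.mul_re, Complex.mul_im,
    Complex.ofReal_re, Complex.ofReal_im, Complex.I_re, Complex.I_im, Complex.sub_im,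
    Complex.add_im, Complex.one_re, Complex.one_im, Complex.zero_re,
    show (s : ℂ) ^ 4 = ((s ^ 4 : ℝ) : ℂ) by push_cast; rfl] at hre
  have hs2 : (1 + s ^ 2) ≠ 0 := by positivity
  have e4 : x ^ 2 + y ^ 2 = 1 := Real.cos_sq_add_sin_sq θ
  rw [hk]
  field_simp
  linear_combination -hre - 2 * s ^ 2 * F2.re * e4

include hs hk hμ hode in
/-- The values on the unit circle. -/
lemma eulerSum_circle {θ : ℝ} (hθ : θ ∈ Icc 0 π) :
    √(1 - k ^ 2 * Real.cos θ ^ 2) * (eulerSum a 1 (Complex.exp (θ * I))).im =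
      μ / (1 + s ^ 2) * ((eulerSum a 0 1).re + c) *
        Real.sin (μ / (1 + s ^ 2) * cosPhase k θ) := by
  have hk' := modulus_mem_Ioo hs hk
  have hν : μ / (1 + s ^ 2) ≠ 0 := by positivity
  have hr : ∀ θ, √(1 - k ^ 2 * Real.cos θ ^ 2) ≠ 0 := fun θ =>
    (Real.sqrt_pos.2 (delta_pos hk' θ)).ne'
  have hF0 := fun θ => (hasDerivAt_eulerSum_circle hR ha 0 θ).re_comp
  have hF1 := fun θ => (hasDerivAt_eulerSum_circle hR ha 1 θ).im_comp
  have hw : ∀ θ, HasDerivAt (fun θ => 1 - k ^ 2 * Real.cos θ ^ 2)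
      (k ^ 2 * (2 * (Real.sin θ * Real.cos θ))) θ := by
    intro θ
    refine (((Real.hasDerivAt_cos θ).pow 2).const_mul (k ^ 2) |>.const_sub 1).congr_deriv ?_
    simp only [Nat.add_one_sub_one, pow_one, Nat.cast_ofNat]
    ring
  have hsol := (eq_cos_of_hasDerivAt (b := π) (μ := μ / (1 + s ^ 2))
    (y := fun θ => (eulerSum a 0 (Complex.exp (θ * I))).re + c)
    (p := fun θ => -(√(1 - k ^ 2 * Real.cos θ ^ 2) * (eulerSum a 1 (Complex.exp (θ * I))).im))
    (r := fun θ => √(1 - k ^ 2 * Real.cos θ ^ 2))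
    (β := fun θ => μ / (1 + s ^ 2) * cosPhase k θ) hν (by simp [cosPhase]) ?_
    (fun θ _ => hr θ) (fun θ _ => ?_) (fun θ _ => ?_) (fun θ _ => ?_) hθ).2
  · simp only [Complex.ofReal_zero, zero_mul, Complex.exp_zero] at hsol
    linarith
  · have := eulerSum_ofReal_im a 1 1
    simp only [Complex.ofReal_one] at this
    simp [this]
  · refine ((hasDerivAt_cosPhase hk' θ).const_mul _).congr_deriv ?_
    ring
  · refine ((hF0 θ).add_const c).congr_deriv ?_
    simp
    field_simp [hr θ]
  · refine (((hw θ).sqrt (delta_pos hk' θ).ne').mul (hF1 θ)).neg.congr_deriv ?_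
    have h := circle_ode hR hk hode θ
    have h2 := Real.sq_sqrt (delta_pos hk' θ).le
    have h3 := hr θ
    simp only [Complex.I_re, Complex.I_im, Complex.mul_im, zero_mul, one_mul, zero_add]
    rw [neg_div, ← h]
    congr 1
    field_simp
    rw [h2]
    ring

include hs hk hμ hode in
/-- The values on the real segment `[s, 1]`. -/
lemma eulerSum_segment {q : ℝ} (hq : q = (1 - s ^ 2) / (1 + s ^ 2)) :
    (eulerSum a 0 1).re + c =
      ((eulerSum a 0 s).re + c) * Real.cosh (μ / (1 + s ^ 2) * sinPhase q (π / 2)) ∧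
    q * (eulerSum a 1 1).re = μ / (1 + s ^ 2) * ((eulerSum a 0 s).re + c) *
      Real.sinh (μ / (1 + s ^ 2) * sinPhase q (π / 2)) := by
  obtain ⟨hs0, hs1⟩ := hs
  have hpi := Real.pi_pos
  have hk0 : 0 < k := (modulus_mem_Ioo ⟨hs0, hs1⟩ hk).1
  have hkq : k ^ 2 + q ^ 2 = 1 := by
    rw [hk, hq]
    field_simp
    ring
  have hq0 : 0 < q := by
    rw [hq]
    have : 0 < 1 - s ^ 2 := by nlinarith
    positivity
  have hq' : q ∈ Ioo (0 : ℝ) 1 := ⟨hq0, by nlinarith⟩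
  have hν : μ / (1 + s ^ 2) ≠ 0 := by positivity
  set r : ℝ → ℝ := fun ψ => √(1 - q ^ 2 * Real.sin ψ ^ 2) with hr
  have hr0 : ∀ ψ, 0 < r ψ := fun ψ => Real.sqrt_pos.2 (one_sub_sq_mul_sin_sq_pos hq' ψ)
  have hr2 : ∀ ψ, r ψ ^ 2 = 1 - q ^ 2 * Real.sin ψ ^ 2 := fun ψ =>
    Real.sq_sqrt (one_sub_sq_mul_sin_sq_pos hq' ψ).le
  have hr2' : ∀ ψ, r ψ ^ 2 = k ^ 2 + q ^ 2 * Real.cos ψ ^ 2 := fun ψ => by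
    rw [hr2, Real.sin_sq]
    linear_combination -hkq
  set z : ℝ → ℝ := fun ψ => (r ψ - q * Real.cos ψ) / k with hz
  have hz0 : ∀ ψ, 0 < z ψ := fun ψ => by
    have := hr0 ψ
    have := hr2' ψ
    refine div_pos ?_ hk0
    nlinarith [sq_pos_of_pos hk0]
  have hz1 : ∀ ψ ∈ Icc 0 (π / 2), z ψ ≤ 1 := fun ψ hψ => by
    have h1 := hr0 ψ
    have h2 := hr2' ψ
    have h3 : 0 ≤ Real.cos ψ := Real.cos_nonneg_of_mem_Icc ⟨by linarith [hψ.1], hψ.2⟩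
    rw [hz, div_le_one hk0]
    nlinarith [mul_nonneg hq0.le h3, mul_nonneg (mul_nonneg hq0.le h3) hk0.le]
  have hdr : ∀ ψ, HasDerivAt r (-(q ^ 2 * (Real.sin ψ * Real.cos ψ)) / r ψ) ψ := fun ψ => by
    have h1 : HasDerivAt (fun ψ => 1 - q ^ 2 * Real.sin ψ ^ 2)
        (-(q ^ 2 * (2 * (Real.sin ψ * Real.cos ψ)))) ψ := by
      refine (((Real.hasDerivAt_sin ψ).pow 2).const_mul (q ^ 2) |>.const_sub 1).congr_deriv ?_
      simp only [Nat.add_one_sub_one, pow_one, Nat.cast_ofNat]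
      ring
    refine (h1.sqrt (one_sub_sq_mul_sin_sq_pos hq' ψ).ne').congr_deriv ?_
    have := hr0 ψ
    change _ / (2 * r ψ) = _
    field_simp
  have hdz : ∀ ψ, HasDerivAt z (z ψ * (q * Real.sin ψ / r ψ)) ψ := fun ψ => by
    refine (((hdr ψ).sub ((Real.hasDerivAt_cos ψ).const_mul q)).div_const k).congr_deriv ?_
    have := hr0 ψ
    simp only [hz]
    field_simp
    ring
  have hF : ∀ j, ∀ ψ ∈ Icc 0 (π / 2), HasDerivAt (fun ψ => (eulerSum a j (z ψ)).re)
      ((eulerSum a (j + 1) (z ψ)).re * (q * Real.sin ψ / r ψ)) ψ := by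
    intro j ψ hψ
    have hn : ‖(z ψ : ℂ)‖ < R := by
      rw [Complex.norm_real, Real.norm_of_nonneg (hz0 ψ).le]
      exact (hz1 ψ hψ).trans_lt hR
    have hzc : (z ψ : ℂ) ≠ 0 := by exact_mod_cast (hz0 ψ).ne'
    have h := ((hasDerivAt_eulerSum (zero_lt_one.trans hR) ha j hn hzc).comp_ofReal).re_comp
    refine (h.comp ψ (hdz ψ)).congr_deriv ?_
    rw [Complex.div_ofReal_re]
    have := (hz0 ψ).ne'
    field_simp
  have hode' : ∀ ψ ∈ Icc 0 (π / 2), q ^ 2 * Real.sin ψ ^ 2 * (eulerSum a 2 (z ψ)).re +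
      r ψ * (q * Real.cos ψ) * (eulerSum a 1 (z ψ)).re =
        (μ / (1 + s ^ 2)) ^ 2 * ((eulerSum a 0 (z ψ)).re + c) := by
    intro ψ hψ
    have hn : ‖(z ψ : ℂ)‖ < R := by
      rw [Complex.norm_real, Real.norm_of_nonneg (hz0 ψ).le]
      exact (hz1 ψ hψ).trans_lt hR
    have h := hode (z ψ) hn
    have hreal : ∀ j, eulerSum a j (z ψ) = ((eulerSum a j (z ψ)).re : ℂ) := fun j =>
      Complex.ext (by simp) (by simp [eulerSum_ofReal_im])
    rw [eulerODE, hreal 0, hreal 1, hreal 2] at h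
    norm_cast at h
    set f0 := (eulerSum a 0 (z ψ)).re
    set f1 := (eulerSum a 1 (z ψ)).re
    set f2 := (eulerSum a 2 (z ψ)).re
    have hzk : z ψ * k = r ψ - q * Real.cos ψ := div_mul_cancel₀ _ hk0.ne'
    have hzy : z ψ * (r ψ + q * Real.cos ψ) = k := by
      refine mul_right_cancel₀ hk0.ne' ?_
      linear_combination (r ψ + q * Real.cos ψ) * hzk + hr2' ψ
    have hE : s ^ 2 * (2 * (r ψ ^ 2 + q ^ 2 * Real.cos ψ ^ 2) * f2 -
        4 * (r ψ * (q * Real.cos ψ)) * f1) - k ^ 2 * (1 + s ^ 4) * f2 + k ^ 2 * μ ^ 2 * (f0 + c)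
          = 0 := by
      refine mul_left_cancel₀ (pow_ne_zero 2 (hz0 ψ).ne') ?_
      linear_combination k ^ 2 * h + s ^ 2 * (f2 - f1) *
        (z ψ * (r ψ + q * Real.cos ψ) + k) * hzy -
        z ψ ^ 2 * s ^ 2 * (f2 + f1) * (z ψ * k + (r ψ - q * Real.cos ψ)) * hzk
    have hD : k ^ 2 * (1 + s ^ 2) ^ 2 = 4 * s ^ 2 := by
      rw [hk]
      field_simp
      norm_num
    have hS : 2 * (1 + s ^ 4) = (1 + q ^ 2) * (1 + s ^ 2) ^ 2 := by
      rw [hq]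
      field_simp
      ring
    rw [div_pow, div_mul_eq_mul_div, eq_div_iff (by positivity)]
    refine mul_left_cancel₀ (pow_ne_zero 2 hk0.ne') ?_
    linear_combination -hE + (q ^ 2 * Real.sin ψ ^ 2 * f2 + r ψ * (q * Real.cos ψ) * f1) * hD +
      2 * s ^ 2 * f2 * hr2' ψ + 4 * s ^ 2 * q ^ 2 * f2 * Real.sin_sq_add_cos_sq ψ -
      k ^ 2 / 2 * f2 * hS - (1 + q ^ 2) / 2 * f2 * hD + 2 * s ^ 2 * f2 * hkq
  have hsol := eq_cosh_of_hasDerivAt (b := π / 2) (μ := μ / (1 + s ^ 2))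
    (y := fun ψ => (eulerSum a 0 (z ψ)).re + c)
    (p := fun ψ => q * Real.sin ψ * (eulerSum a 1 (z ψ)).re)
    (r := r) (β := fun ψ => μ / (1 + s ^ 2) * sinPhase q ψ) hν (by simp [sinPhase]) (by simp)
    (fun ψ _ => (hr0 ψ).ne')
    (fun ψ _ => ((hasDerivAt_sinPhase hq' ψ).const_mul _).congr_deriv (by simp only [hr]; ring))
    (fun ψ hψ => ((hF 0 ψ hψ).add_const c).congr_deriv (by ring))
    (fun ψ hψ => (((Real.hasDerivAt_sin ψ).const_mul q).mul (hF 1 ψ hψ)).congr_deriv (by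
      rw [← hode' ψ hψ]
      have := (hr0 ψ).ne'
      field_simp
      ring))
    (x := π / 2) ⟨by linarith, le_rfl⟩
  have hzs : z 0 = s := by
    simp [hz, hr]
    rw [hk, hq]
    field_simp
    ring
  have hz1 : z (π / 2) = 1 := by
    have h1 := hr2' (π / 2)
    have h2 : r (π / 2) = k := by
      have := hr0 (π / 2)
      simp only [Real.cos_pi_div_two] at h1
      nlinarith
    simp only [hz, h2, Real.cos_pi_div_two]
    field_simp
    ring
  simpa [hzs, hz1] using hsol

end solution

section derivative

variable {a : ℕ → ℝ} {R C : ℝ} (hR : 1 < R) (ha : ∀ n, |a n| * R ^ n ≤ C)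
include hR ha

lemma hasDerivAt_eulerSum_re {x : ℝ} (hx : |x| < R) :
    HasDerivAt (fun x : ℝ => (eulerSum a 0 x).re) (∑' n : ℕ, ((n : ℝ) + 1) * a (n + 1) * x ^ n)
      x := by
  have h := (hasDerivAt_eulerSum_tsum (zero_lt_one.trans hR) ha 0 (z := x)
    (by simpa using hx)).comp_ofReal.re_comp
  refine h.congr_deriv ?_
  have e : ∑' n : ℕ, ((n : ℂ) ^ 0 * a n) * (n * (x : ℂ) ^ (n - 1)) =
      ((∑' n : ℕ, a n * (n * x ^ (n - 1)) : ℝ) : ℂ) := by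
    rw [Complex.ofReal_tsum]
    push_cast
    simp
  have hsum := summable_pow_mul_abs_mul_pow (zero_lt_one.trans hR) ha 1 (abs_nonneg x) hx
  have hs' : Summable fun n : ℕ => a n * (n * x ^ (n - 1)) := by
    rcases eq_or_ne x 0 with rfl | hx0
    · refine summable_of_ne_finset_zero (s := {1}) fun n hn => ?_
      rcases n with _ | _ | n
      · simp
      · simp at hn
      · simp
    refine Summable.of_norm ((hsum.div_const |x|).congr fun n => ?_)
    have := abs_pos.2 hx0
    cases n with
    | zero => simp
    | succ n =>
      rw [div_eq_iff this.ne', Nat.add_sub_cancel, norm_mul, norm_mul, norm_pow]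
      simp only [Real.norm_eq_abs, Nat.abs_cast]
      ring
  rw [e, Complex.ofReal_re, hs'.tsum_eq_zero_add]
  simp only [CharP.cast_eq_zero, zero_mul, mul_zero, zero_add, Nat.add_sub_cancel]
  refine tsum_congr fun n => ?_
  push_cast
  ring

lemma summable_succ_mul_coeff : Summable fun n : ℕ => |((n : ℝ) + 1) * a (n + 1)| * (n + 1) := by
  refine ((summable_nat_add_iff 1).2 (summable_pow_mul_abs_mul_pow (zero_lt_one.trans hR) ha 2
    zero_le_one hR)).congr fun n => ?_
  rw [abs_mul, abs_of_nonneg (by positivity : (0 : ℝ) ≤ n + 1)]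
  push_cast
  ring

lemma hasSum_eulerSum_one {z : ℂ} (hz : ‖z‖ < R) :
    HasSum (fun n : ℕ => (((n : ℝ) + 1) * a (n + 1) : ℝ) * z ^ (n + 1)) (eulerSum a 1 z) := by
  have h := (hasSum_nat_add_iff' 1).2 (hasSum_eulerSum (zero_lt_one.trans hR) ha 1 hz)
  simp only [Finset.sum_range_one, CharP.cast_eq_zero, zero_mul, sub_zero, pow_one] at h
  refine h.congr_term fun n => ?_
  push_cast
  ring

lemma tsum_succ_mul_coeff : ∑' n : ℕ, ((n : ℝ) + 1) * a (n + 1) = (eulerSum a 1 1).re := by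
  have h := Complex.reCLM.hasSum (hasSum_eulerSum_one hR ha (z := 1) (by simpa using hR))
  refine HasSum.tsum_eq ?_
  simpa using h

lemma tsum_mul_cotKer (θ : ℝ) :
    (∑' n : ℕ, ((n : ℝ) + 1) * a (n + 1) * cotKer (n + 1) θ) * Real.sin θ =
      (1 + Real.cos θ) * (eulerSum a 1 (Complex.exp (θ * I))).im := by
  have h := Complex.imCLM.hasSum (hasSum_eulerSum_one hR ha (z := Complex.exp (θ * I))
    (by simpa [Complex.norm_exp_ofReal_mul_I] using hR))
  have h' := h.mul_left (1 + Real.cos θ)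
  rw [← tsum_mul_right]
  refine (tsum_congr fun n => ?_).trans h'.tsum_eq
  have e : Complex.exp (θ * I) ^ (n + 1) = Complex.exp (((n + 1 : ℕ) * θ : ℝ) * I) := by
    rw [← Complex.exp_nat_mul]
    push_cast
    ring_nf
  rw [mul_assoc, cotKer_mul_sin]
  simp only [e, Complex.imCLM_apply, Complex.im_ofReal_mul,
    Complex.exp_ofReal_mul_I_im]
  ring

end derivative

section lambda

variable {k : ℝ} (hk : k ∈ Ioo (0 : ℝ) 1)
include hk

lemma hasDerivAt_lamFun (φ : ℝ) :
    HasDerivAt (lamFun k) (-(k * Real.sin φ / (√(1 - k ^ 2 * Real.cos φ ^ 2) *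
      (1 + √(1 - k ^ 2 * Real.cos φ ^ 2))))) φ := by
  have h := Real.sqrt_pos.2 (delta_pos hk φ)
  have h2 := Real.sq_sqrt (delta_pos hk φ).le
  have hd : HasDerivAt (fun φ => 1 - k ^ 2 * Real.cos φ ^ 2)
      (-(k ^ 2 * (2 * Real.cos φ * -Real.sin φ))) φ := by
    simpa using (((Real.hasDerivAt_cos φ).pow 2).const_mul (k ^ 2)).const_sub 1
  refine (((Real.hasDerivAt_cos φ).const_mul k).div ((hd.sqrt (delta_pos hk φ).ne').const_add 1)
    (by positivity)).congr_deriv ?_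
  set r := √(1 - k ^ 2 * Real.cos φ ^ 2)
  field_simp
  linear_combination -(k * Real.sin φ) * h2

lemma one_add_div_one_sub_lamFun (φ : ℝ) :
    (1 + lamFun k φ) / (1 - lamFun k φ) =
      √(1 - k ^ 2 * Real.cos φ ^ 2) / (1 - k * Real.cos φ) := by
  have h := Real.sqrt_pos.2 (delta_pos hk φ)
  have h2 := Real.sq_sqrt (delta_pos hk φ).le
  have h3 := one_sub_mul_cos_pos hk φ
  have h4 := (abs_lt.1 (abs_lamFun_lt hk φ)).2
  rw [div_eq_div_iff (by linarith) h3.ne']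
  rw [lamFun]
  set r := √(1 - k ^ 2 * Real.cos φ ^ 2)
  field_simp
  linear_combination (-1 : ℝ) * h2

variable {s : ℝ} (hs : s ∈ Ioo (0 : ℝ) 1) (hks : k = 2 * s / (1 + s ^ 2))
include hs hks

omit hk in
lemma lamFun_zero : lamFun k 0 = s := by
  obtain ⟨h0, h1⟩ := hs
  have e : 1 - k ^ 2 = ((1 - s ^ 2) / (1 + s ^ 2)) ^ 2 := by
    rw [hks]
    field_simp
    ring
  have h2 : 0 ≤ (1 - s ^ 2) / (1 + s ^ 2) := div_nonneg (by nlinarith) (by positivity)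
  rw [lamFun, Real.cos_zero, one_pow, mul_one, mul_one, e, Real.sqrt_sq h2, hks]
  field_simp
  ring

omit hs in
lemma quartic_lamFun (φ : ℝ) :
    (s ^ 2 - lamFun k φ ^ 2) * (1 - s ^ 2 * lamFun k φ ^ 2) =
      (s * Real.sin φ * (1 + lamFun k φ ^ 2)) ^ 2 := by
  have h := lamFun_div hk φ
  rw [div_eq_iff (by positivity)] at h
  have h0 : k * (1 + s ^ 2) = 2 * s := by
    rw [hks]
    field_simp
  have h1 : lamFun k φ * (1 + s ^ 2) = s * Real.cos φ * (1 + lamFun k φ ^ 2) := by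
    linear_combination (1 + s ^ 2) * h + Real.cos φ * (1 + lamFun k φ ^ 2) / 2 * h0
  linear_combination -(lamFun k φ * (1 + s ^ 2) + s * Real.cos φ * (1 + lamFun k φ ^ 2)) * h1 -
    s ^ 2 * (1 + lamFun k φ ^ 2) ^ 2 * Real.sin_sq_add_cos_sq φ

lemma lamFun_sq_lt {φ : ℝ} (hφ : φ ∈ Ioo 0 π) : lamFun k φ ^ 2 < s ^ 2 := by
  have h := quartic_lamFun hk hks φ
  have h1 := Real.sin_pos_of_mem_Ioo hφ
  have h2 := (sq_lt_one_iff_abs_lt_one _).2 (abs_lamFun_lt hk φ)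
  have h3 : s ^ 2 < 1 := by nlinarith [hs.1, hs.2]
  have h4 : 0 < 1 - s ^ 2 * lamFun k φ ^ 2 := by nlinarith [sq_nonneg s, sq_nonneg (lamFun k φ)]
  have h5 := hs.1
  have h6 : 0 < (s ^ 2 - lamFun k φ ^ 2) * (1 - s ^ 2 * lamFun k φ ^ 2) := by
    rw [h]
    positivity
  linarith [pos_of_mul_pos_left h6 h4.le]

end lambda

lemma Kell_eq_of_landen {s k : ℝ} (hs : s ∈ Ioo (0 : ℝ) 1) (hks : k = 2 * s / (1 + s ^ 2)) :
    Kell k = (1 + s ^ 2) * Kell (s ^ 2) := by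
  have h := Kell_landen (k := s ^ 2) ⟨pow_pos hs.1 2, by nlinarith [hs.1, hs.2]⟩
  rwa [Real.sqrt_sq hs.1.le, ← hks] at h

section circle

variable {s : ℝ} (hs : s ∈ Ioo (0 : ℝ) 1) {k : ℝ} (hks : k = 2 * s / (1 + s ^ 2))
  {v : ℂ → ℂ} (hv : IsVmap (s ^ 2) v)
  {a : ℕ → ℕ → ℝ} (ha : IsCoeff (s ^ 2) v a) {m : ℕ} (hm : 1 ≤ m)

include hs hks hv in
/-- The value of `v` along `λ(φ)`. -/
lemma IsVmap.comp_lamFun {φ : ℝ} (hφ : φ ∈ Ioo 0 π) :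
    2 * (π : ℂ) * m * (v (lamFun k φ) + 1 / 4) =
      ((π * m - 2 * π * m / (4 * Kell k) * cosPhase k φ : ℝ) : ℂ) := by
  have hk := modulus_mem_Ioo hs hks
  have hK := Kell_pos hk
  have hKs := Kell_eq_of_landen hs hks
  have hd : ∀ φ ∈ Ioo 0 π, HasDerivAt (fun φ : ℝ => 2 * (π : ℂ) * m * (v (lamFun k φ) + 1 / 4) +
      ((2 * π * m / (4 * Kell k) * cosPhase k φ : ℝ) : ℂ)) 0 φ := by
    intro φ hφ
    have h1 := ((hasDerivAt_cos_v hs hv m (lamFun_sq_lt hk hs hks hφ)).comp_ofReal).scomp φ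
      (hasDerivAt_lamFun hk φ)
    have h2 := ((hasDerivAt_cosPhase hk φ).const_mul (2 * π * m / (4 * Kell k))).ofReal_comp
    refine (h1.add h2).congr_deriv ?_
    rw [quartic_lamFun hk hks, Complex.real_smul, ← Complex.ofReal_mul, ← Complex.ofReal_add,
      Complex.ofReal_eq_zero]
    have hsin := Real.sin_pos_of_mem_Ioo hφ
    have hs0 := hs.1
    rw [Real.sqrt_sq (by positivity), one_add_lamFun_sq hk, hKs]
    have hr := Real.sqrt_pos.2 (delta_pos hk φ)
    set r := √(1 - k ^ 2 * Real.cos φ ^ 2)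
    have hK2 : 0 < Kell (s ^ 2) := by
      rw [hKs] at hK
      exact pos_of_mul_pos_right hK (by positivity)
    rw [hks]
    field_simp
    ring
  have hc := isOpen_Ioo.is_const_of_deriv_eq_zero isPreconnected_Ioo
    (fun x hx => (hd x hx).differentiableAt.differentiableWithinAt)
    (fun x hx => (hd x hx).deriv) hφ (show π / 2 ∈ Ioo 0 π from ⟨by positivity, by linarith [pi_pos]⟩)
  have h0 : lamFun k (π / 2) = 0 := by simp [lamFun]
  have h1 : 2 * π * m / (4 * Kell k) * cosPhase k (π / 2) = π * m / 2 := by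
    rw [cosPhase, ← Kell_eq_integral_cos hk]
    field_simp
    ring
  simp only [h0, h1, Complex.ofReal_zero, hv.map_zero] at hc
  push_cast at hc ⊢
  linear_combination hc

include hs hks hv ha hm in
lemma IsCoeff.eulerSum_lamFun {φ : ℝ} (hφ : φ ∈ Ioo 0 π) :
    (eulerSum (fun n => a n m) 0 (lamFun k φ)).re =
      (-1) ^ m * Real.cos (2 * π * m / (4 * Kell k) * cosPhase k φ) - Real.cos (π * m / 2) := by
  have hk := modulus_mem_Ioo hs hks
  rw [ha.eulerSum_zero hm (mem_slitDom_ofReal (lamFun_sq_lt hk hs hks hφ))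
    (by simpa using abs_lamFun_lt hk φ), fmFun, hv.comp_lamFun hs hks hφ,
    show (π : ℂ) * m / 2 = ((π * m / 2 : ℝ) : ℂ) by push_cast; rfl, ← Complex.ofReal_cos,
    ← Complex.ofReal_cos, ← Complex.ofReal_sub, Complex.ofReal_re, mul_comm π (m : ℝ),
    Real.cos_nat_mul_pi_sub]

include hs hks hv ha hm in
lemma IsCoeff.eulerSum_at_sqrt {R C : ℝ} (hR : 1 < R) (hC : ∀ n, |a n m| * R ^ n ≤ C) :
    (eulerSum (fun n => a n m) 0 s).re = (-1) ^ m - Real.cos (π * m / 2) := by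
  have hk := modulus_mem_Ioo hs hks
  have h1 : ContinuousAt (fun φ => (eulerSum (fun n => a n m) 0 (lamFun k φ)).re) 0 :=
    ((hasDerivAt_eulerSum_re hR hC ((abs_lamFun_lt hk 0).trans hR)).continuousAt).comp
      (f := lamFun k) (continuous_lamFun k).continuousAt
  have h2 : ContinuousAt (fun φ => (-1) ^ m * Real.cos (2 * π * m / (4 * Kell k) * cosPhase k φ) -
      Real.cos (π * m / 2)) 0 :=
    ((((hasDerivAt_cosPhase hk 0).const_mul _).cos.const_mul _).sub_const _).continuousAt
  have h3 := tendsto_nhds_unique_of_eventuallyEq (l := nhdsWithin 0 (Ioi 0))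
    (h1.tendsto.mono_left nhdsWithin_le_nhds) (h2.tendsto.mono_left nhdsWithin_le_nhds) (by
      filter_upwards [Ioo_mem_nhdsGT pi_pos] with φ hφ
      exact ha.eulerSum_lamFun hs hks hv hm hφ)
  rw [lamFun_zero hs hks] at h3
  simpa [cosPhase] using h3

include hs hks hv ha hm in
lemma IsCoeff.tsum_mul_lamFun_pow {R C : ℝ} (hR : 1 < R) (hC : ∀ n, |a n m| * R ^ n ≤ C) {φ : ℝ}
    (hφ : φ ∈ Ioo 0 π) :
    (∑' n : ℕ, ((n : ℝ) + 1) * a (n + 1) m * lamFun k φ ^ n) * (k * Real.sin φ) =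
      (-1) ^ m * (2 * π * m / (4 * Kell k)) *
        Real.sin (2 * π * m / (4 * Kell k) * cosPhase k φ) *
        (1 + √(1 - k ^ 2 * Real.cos φ ^ 2)) := by
  have hk := modulus_mem_Ioo hs hks
  have h1 := (hasDerivAt_eulerSum_re hR hC ((abs_lamFun_lt hk φ).trans hR)).comp φ
    (hasDerivAt_lamFun hk φ)
  have h2 := ((((hasDerivAt_cosPhase hk φ).const_mul (2 * π * m / (4 * Kell k))).cos.const_mul
    ((-1 : ℝ) ^ m)).sub_const (Real.cos (π * m / 2)))
  have h3 := h1.unique (h2.congr_of_eventuallyEq (by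
    filter_upwards [isOpen_Ioo.mem_nhds hφ] with y hy
    exact ha.eulerSum_lamFun hs hks hv hm hy))
  have hr := Real.sqrt_pos.2 (delta_pos hk φ)
  have hK := Kell_pos hk
  set r := √(1 - k ^ 2 * Real.cos φ ^ 2)
  set ν := 2 * π * m / (4 * Kell k)
  field_simp at h3
  linear_combination -h3

end circle

lemma intervalIntegral_congr_Ioo {f g : ℝ → ℝ} {b : ℝ} (hb : 0 ≤ b)
    (h : ∀ x ∈ Ioo 0 b, f x = g x) : ∫ x in (0 : ℝ)..b, f x = ∫ x in (0 : ℝ)..b, g x := by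
  rw [intervalIntegral.integral_of_le hb, intervalIntegral.integral_of_le hb,
    MeasureTheory.integral_Ioc_eq_integral_Ioo, MeasureTheory.integral_Ioc_eq_integral_Ioo]
  exact MeasureTheory.setIntegral_congr_fun measurableSet_Ioo h

lemma kLanden_spec {k : ℝ} (hk : k ∈ Ioo (0 : ℝ) 1) :
    ∃ s ∈ Ioo (0 : ℝ) 1, kLanden k = s ^ 2 ∧ k = 2 * s / (1 + s ^ 2) ∧
      kComp k = (1 - s ^ 2) / (1 + s ^ 2) := by
  obtain ⟨h0, h1⟩ := hk
  have hq2 : kComp k ^ 2 = 1 - k ^ 2 := Real.sq_sqrt (by nlinarith)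
  have hq0 : 0 < kComp k := Real.sqrt_pos.2 (by nlinarith)
  have hq1 : kComp k < 1 := by nlinarith
  have hpos : 0 < kLanden k := div_pos (by linarith) (by linarith)
  have hlt : kLanden k < 1 := by
    rw [kLanden, div_lt_one (by linarith)]
    linarith
  have hs2 : √(kLanden k) ^ 2 = kLanden k := Real.sq_sqrt hpos.le
  have hs0 : 0 < √(kLanden k) := Real.sqrt_pos.2 hpos
  have h2 : 1 + √(kLanden k) ^ 2 = 2 / (1 + kComp k) := by
    rw [hs2, kLanden]
    field_simp
    ring
  refine ⟨√(kLanden k), ⟨hs0, by rw [Real.sqrt_lt' one_pos]; simpa using hlt⟩, hs2.symm, ?_, ?_⟩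
  · rw [h2]
    refine (sq_eq_sq₀ h0.le (by positivity)).1 ?_
    rw [div_pow, mul_pow, hs2, kLanden]
    field_simp
    linear_combination hq2
  · rw [h2, hs2, kLanden]
    field_simp
    ring

section evaluation

variable {s : ℝ} (hs : s ∈ Ioo (0 : ℝ) 1) {k : ℝ} (hks : k = 2 * s / (1 + s ^ 2))
  {v : ℂ → ℂ} (hv : IsVmap (s ^ 2) v)
  {a : ℕ → ℕ → ℝ} (ha : IsCoeff (s ^ 2) v a) {m : ℕ} (hm : 1 ≤ m)
include hs hks hv ha hm

lemma IsCoeff.hasSum_half_add_Cgen_mul {q X : ℝ} (hq : q = (1 - s ^ 2) / (1 + s ^ 2))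
    (hX : X = 2 * π * m / (4 * Kell k) * Kell q) :
    HasSum (fun n : ℕ => (1 / 2 + Cgen (k / 4) (n + 1)) * ((n : ℝ) + 1) * a (n + 1) m)
      ((-1) ^ m * (π * m / (4 * (1 - k) * Kell k)) *
        (Real.sinh X * Real.cosh X / (1 + Real.cosh X))) := by
  have hk := modulus_mem_Ioo hs hks
  have hK := Kell_pos hk
  have hKs := Kell_eq_of_landen hs hks
  obtain ⟨hs0, hs1⟩ := hs
  have hqI : q ∈ Ioo (0 : ℝ) 1 := by
    rw [hq]
    refine ⟨div_pos (by nlinarith) (by positivity), ?_⟩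
    rw [div_lt_one (by positivity)]
    nlinarith
  obtain ⟨R, hR, C, hC⟩ := ha.exists_decay ⟨hs0, hs1⟩ hv hm
  have hode : ∀ z : ℂ, ‖z‖ < R → eulerODE (fun n => a n m) s (2 * π * m / (4 * Kell (s ^ 2)))
      (Real.cos (π * m / 2)) z = 0 := by
    intro z hz
    refine (hasSum_eulerODE (zero_lt_one.trans hR) hC s _ _ hz).unique ?_
    have h0 := eulerODECoeff_eq_zero (zero_lt_one.trans hR) hC hs0 fun x hx =>
      ha.eulerODE_eq_zero_of_lt ⟨hs0, hs1⟩ hv hm hx.1 hx.2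
    simp only [h0, Complex.ofReal_zero, zero_mul]
    exact hasSum_zero
  have hm' : (m : ℝ) ≠ 0 := by exact_mod_cast (by omega : m ≠ 0)
  have hK2 : 0 < Kell (s ^ 2) := by
    rw [hKs] at hK
    exact pos_of_mul_pos_right hK (by positivity)
  have hμ : 2 * π * m / (4 * Kell (s ^ 2)) ≠ 0 := by positivity
  have hν : 2 * π * m / (4 * Kell (s ^ 2)) / (1 + s ^ 2) = 2 * π * m / (4 * Kell k) := by
    rw [hKs]
    field_simp
  have hcirc := fun θ (hθ : θ ∈ Icc 0 π) => eulerSum_circle hR hC ⟨hs0, hs1⟩ hks hμ hode hθ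
  obtain ⟨hF, hF'⟩ := eulerSum_segment hR hC ⟨hs0, hs1⟩ hks hμ hode hq
  have hFs := ha.eulerSum_at_sqrt ⟨hs0, hs1⟩ hks hv hm hR hC
  have hlam := fun φ hφ => ha.tsum_mul_lamFun_pow ⟨hs0, hs1⟩ hks hv hm hR hC (φ := φ) hφ
  have hXs : 2 * π * m / (4 * Kell k) * sinPhase q (π / 2) = X := by
    rw [hX, sinPhase, Kell_eq_integral_sin hqI]
  rw [hν, hXs, hFs, sub_add_cancel] at hF hF'
  simp only [hν, hF] at hcirc
  have hb := summable_succ_mul_coeff hR hC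
  have hsum := hasSum_half_add_Cgen hk hb
  have htsum := tsum_half_add_Cgen hk hb
  rw [tsum_succ_mul_coeff hR hC, lamFun_zero ⟨hs0, hs1⟩ hks] at htsum
  set ν := 2 * π * m / (4 * Kell k) with hνd
  set f1 := (eulerSum (fun n => a n m) 1 1).re
  set J := ∫ θ in (0 : ℝ)..π, ν * (1 + Real.cos θ) * Real.sin (ν * cosPhase k θ) /
    (Real.sin θ * (1 - k * Real.cos θ)) with hJ
  have hI1 : ∫ θ in (0 : ℝ)..π, 1 / 2 * ((1 + lamFun k θ) / (1 - lamFun k θ)) *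
      ∑' n : ℕ, ((n : ℝ) + 1) * a (n + 1) m * cotKer (n + 1) θ = (-1) ^ m * Real.cosh X / 2 * J := by
    rw [hJ, ← intervalIntegral.integral_const_mul]
    refine intervalIntegral_congr_Ioo pi_pos.le fun θ hθ => ?_
    have h1 := tsum_mul_cotKer hR hC θ
    have h2 := hcirc θ ⟨hθ.1.le, hθ.2.le⟩
    have hsin := Real.sin_pos_of_mem_Ioo hθ
    have hkc := one_sub_mul_cos_pos hk θ
    simp only [one_add_div_one_sub_lamFun hk]
    field_simp
    linear_combination √(1 - k ^ 2 * Real.cos θ ^ 2) * h1 + (1 + Real.cos θ) * h2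
  have hI2 : ∫ φ in (0 : ℝ)..π, (1 + Real.cos φ) * (k / 4 * ((1 + lamFun k φ ^ 2) /
      (1 - k * Real.cos φ))) * ∑' n : ℕ, ((n : ℝ) + 1) * a (n + 1) m * lamFun k φ ^ n =
      (-1) ^ m / 2 * J := by
    rw [hJ, ← intervalIntegral.integral_const_mul]
    refine intervalIntegral_congr_Ioo pi_pos.le fun θ hθ => ?_
    have h1 := hlam θ hθ
    have hsin := Real.sin_pos_of_mem_Ioo hθ
    have hkc := one_sub_mul_cos_pos hk θ
    have hr := Real.sqrt_pos.2 (delta_pos hk θ)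
    simp only [one_add_lamFun_sq hk]
    set r := √(1 - k ^ 2 * Real.cos θ ^ 2)
    set d := 1 - k * Real.cos θ
    clear_value r d ν
    field_simp
    linear_combination 4 * (1 + Real.cos θ) * h1
  rw [hI1] at hsum
  rw [hsum.tsum_eq, hI2] at htsum
  have hc := Real.cosh_pos X
  have hq0 := hqI.1
  have hsgn : ((-1 : ℝ) ^ m) ^ 2 = 1 := by rw [← pow_mul, mul_comm, pow_mul]; simp
  have hf1 : f1 = ν * (-1) ^ m * Real.sinh X / q := by
    rw [eq_div_iff hq0.ne']
    linear_combination hF'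
  have hks' : (1 + s) / (1 - s) / q = 1 / (1 - k) := by
    have h1 : 0 < 1 - s := by linarith
    have h2 : 0 < 1 - k := by linarith [hk.2]
    have h3 : 0 < 1 - s ^ 2 := by nlinarith
    rw [div_div, div_eq_div_iff (by positivity) h2.ne', hq, hks]
    field_simp
    ring
  have hJ' : J = π * ν * Real.sinh X / (1 - k) / (1 + Real.cosh X) := by
    rw [eq_div_iff (by positivity), div_eq_mul_one_div _ (1 - k), ← hks']
    rw [hf1] at htsum
    field_simp at htsum ⊢
    linear_combination htsum
  have h := hsum.mul_left (1 / π)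
  have hval : (-1) ^ m * (π * m / (4 * (1 - k) * Kell k)) *
      (Real.sinh X * Real.cosh X / (1 + Real.cosh X)) =
      1 / π * ((-1) ^ m * Real.cosh X / 2 * J) := by
    rw [hJ', hνd]
    have h2 : 0 < 1 - k := by linarith [hk.2]
    field_simp
  rw [hval]
  refine h.congr_term fun n => ?_
  field_simp

end evaluation

lemma sinh_mul_cosh_div (X : ℝ) :
    Real.sinh X * Real.cosh X / (1 + Real.cosh X) =
      (Real.exp (2 * X) - Real.exp (-(2 * X))) / (2 *
        (Real.exp (-(X / 2)) + Real.exp (X / 2)) ^ 2) := by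
  have e1 : Real.exp X = Real.exp (X / 2) ^ 2 := by rw [← Real.exp_nat_mul]; ring_nf
  have e2 : Real.exp (2 * X) = Real.exp (X / 2) ^ 4 := by rw [← Real.exp_nat_mul]; ring_nf
  rw [Real.sinh_eq, Real.cosh_eq, Real.exp_neg (2 * X), e2, Real.exp_neg, Real.exp_neg, e1]
  have h := Real.exp_pos (X / 2)
  field_simp
  ring

/-- Lemma 20: for `k ∈ (0,1)`, `t = k/4` and `m ≥ 1`,
`Σ_{n≥1} (1/2 + C_n(t)) n a_{n,m} = (-1)^m (π/(8(1-k)K(k))) m(q^{-m}-q^m)/(q^{m/4}+q^{-m/4})²`,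
the sum converging absolutely. -/
theorem statement18 (k : ℝ) (hk : k ∈ Set.Ioo (0 : ℝ) 1) (t : ℝ) (ht : t = k / 4)
    (v : ℂ → ℂ) (hv : IsVmap (kLanden k) v)
    (a : ℕ → ℕ → ℝ) (ha : IsCoeff (kLanden k) v a)
    (m : ℕ) (hm : 1 ≤ m) :
    Summable (fun n : ℕ => (1 / 2 + Cgen t (n + 1)) * ((n : ℝ) + 1) * a (n + 1) m) ∧
    (∑' n : ℕ, (1 / 2 + Cgen t (n + 1)) * ((n : ℝ) + 1) * a (n + 1) m) =
      (-1 : ℝ) ^ m * (π / (8 * (1 - k) * Kell k)) *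
        ((m : ℝ) * (qNome k ^ (-(m : ℝ)) - qNome k ^ (m : ℝ)) /
          (qNome k ^ ((m : ℝ) / 4) + qNome k ^ (-(m : ℝ) / 4)) ^ 2) := by
  obtain ⟨s, hs, hks2, hks, hq⟩ := kLanden_spec hk
  rw [hks2] at hv ha
  have h := ha.hasSum_half_add_Cgen_mul hs hks hv hm hq rfl
  subst ht
  refine ⟨h.summable, ?_⟩
  rw [h.tsum_eq, sinh_mul_cosh_div]
  have hpow : ∀ y : ℝ, qNome k ^ y = Real.exp (-π * Kell (kComp k) / Kell k * y) := fun y => by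
    rw [qNome, ← Real.exp_mul]
  have hK := Kell_pos hk
  have h2 : 0 < 1 - k := by linarith [hk.2]
  have e1 : 2 * (2 * π * m / (4 * Kell k) * Kell (kComp k)) =
      -π * Kell (kComp k) / Kell k * -(m : ℝ) := by
    field_simp
    ring
  have e2 : 2 * π * m / (4 * Kell k) * Kell (kComp k) / 2 =
      -π * Kell (kComp k) / Kell k * (-(m : ℝ) / 4) := by
    field_simp
  rw [e1, e2, hpow, hpow, hpow, hpow, ← mul_neg, ← mul_neg, neg_neg, ← neg_div, neg_neg]
  have h3 : 0 < Real.exp (-π * Kell (kComp k) / Kell k * ((m : ℝ) / 4)) +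
      Real.exp (-π * Kell (kComp k) / Kell k * (-(m : ℝ) / 4)) := by positivity
  field_simp
  ring

end
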